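/- arXiv:2409.06877 — 3 statements merged into one kernel-verified Lean document; each statement's English description precedes it below -/
import Mathlib

section
/- Let an (n,m,r) mass action network factor over a partition P, with A_κ defined via any admissible choices of h and W as in the context. (i) If s_P ≤ r, then A_κ is finite for all κ in a nonempty Zariski-open subset of ℝ^m_+. (ii) If s_P > r, then A_κ is finite for all κ in a nonempty Zariski-open subset of ℝ^m_+ if and only if the network is strongly degenerate. In particular, if the network is not strongly degenerate, then A_κ is generically finite if and only if s_P = r. -/
open Matrix

noncomputable section

/-- Entrywise power of a vector by a real exponent matrix:
`(powVec M x) i = ∏ j, (x j) ^ (M i j)` (real powers). -/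
def powVec {k l : ℕ} (M : Matrix (Fin k) (Fin l) ℝ) (x : Fin l → ℝ) : Fin k → ℝ :=
  fun i => ∏ j, x j ^ M i j

/-- Cast an integer matrix to a real matrix. -/
def mR {a b : ℕ} (M : Matrix (Fin a) (Fin b) ℤ) : Matrix (Fin a) (Fin b) ℝ :=
  M.map fun t => (t : ℝ)

/-- The (open) positive orthant. -/
def posOrth (k : ℕ) : Set (Fin k → ℝ) :=
  {x | ∀ i, 0 < x i}

/-- The mass action vector field `g_κ(x) = Γ (κ ∘ x^A)`. -/
def massAction {n m : ℕ} (Γ : Matrix (Fin n) (Fin m) ℤ) (A : Matrix (Fin m) (Fin n) ℤ)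
    (κ : Fin m → ℝ) (x : Fin n → ℝ) : Fin n → ℝ :=
  (mR Γ).mulVec (κ * powVec (mR A) x)

/-- The positive equilibrium set `E_κ`. -/
def Eset {n m : ℕ} (Γ : Matrix (Fin n) (Fin m) ℤ) (A : Matrix (Fin m) (Fin n) ℤ)
    (κ : Fin m → ℝ) : Set (Fin n → ℝ) :=
  {x | (∀ i, 0 < x i) ∧ massAction Γ A κ x = 0}

/-- The Jacobian matrix `Γ D_{κ∘x^A} A D_{1/x}` of `g_κ` at `x`. -/
def jacMat {n m : ℕ} (Γ : Matrix (Fin n) (Fin m) ℤ) (A : Matrix (Fin m) (Fin n) ℤ)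
    (κ : Fin m → ℝ) (x : Fin n → ℝ) : Matrix (Fin n) (Fin n) ℝ :=
  mR Γ * Matrix.diagonal (κ * powVec (mR A) x) * mR A * Matrix.diagonal (fun i => (x i)⁻¹)

/-- Nondegeneracy of an equilibrium: `ker J_{g_κ}(x) ∩ im Γ = {0}`. -/
def nondegAt {n m : ℕ} (Γ : Matrix (Fin n) (Fin m) ℤ) (A : Matrix (Fin m) (Fin n) ℤ)
    (κ : Fin m → ℝ) (x : Fin n → ℝ) : Prop :=
  ∀ z : Fin n → ℝ, (jacMat Γ A κ x).mulVec z = 0 → (∃ v, (mR Γ).mulVec v = z) → z = 0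

/-- Strong degeneracy of the network: every positive equilibrium has Jacobian of
rank less than `rank Γ`, for every choice of rate constants. -/
def stronglyDegenerate {n m : ℕ} (Γ : Matrix (Fin n) (Fin m) ℤ)
    (A : Matrix (Fin m) (Fin n) ℤ) : Prop :=
  ∀ κ ∈ posOrth m, ∀ x ∈ Eset Γ A κ, (jacMat Γ A κ x).rank < (mR Γ).rank

/-- Dynamically nontrivial: the positive flux cone `ker Γ ∩ ℝ^m_+` is nonempty. -/
def dynNontrivial {n m : ℕ} (Γ : Matrix (Fin n) (Fin m) ℤ) : Prop :=
  ∃ v : Fin m → ℝ, (mR Γ).mulVec v = 0 ∧ ∀ j, 0 < v j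

/-- `ker Γ` factors over the partition of `{1,…,m}` given by the fibres of `blk`. -/
def factorsOver {n m p : ℕ} (Γ : Matrix (Fin n) (Fin m) ℤ) (blk : Fin m → Fin p) : Prop :=
  ∀ v : Fin m → ℝ, (mR Γ).mulVec v = 0 →
    ∀ i : Fin p, (mR Γ).mulVec (fun j => if blk j = i then v j else 0) = 0

/-- The matrix `[A | 1_P]`. -/
def srcMat {n m p : ℕ} (A : Matrix (Fin m) (Fin n) ℤ) (blk : Fin m → Fin p) :
    Matrix (Fin m) (Fin (n + p)) ℝ :=
  Matrix.of fun j => Fin.append (fun k => (A j k : ℝ)) (fun i => if blk j = i then 1 else 0)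

/-- The first `n` rows of an `(n+p)×k` matrix. -/
def topRows (n p : ℕ) {k : ℕ} (M : Matrix (Fin (n + p)) (Fin k) ℝ) :
    Matrix (Fin n) (Fin k) ℝ :=
  Matrix.of fun i j => M (Fin.castAdd p i) j

/-- The flux-cone parameterisation `(1_P λ) ∘ h(α)`. -/
def fluxParam {m p d : ℕ} (blk : Fin m → Fin p) (h : (Fin d → ℝ) → (Fin m → ℝ))
    (lam : Fin p → ℝ) (α : Fin d → ℝ) : Fin m → ℝ :=
  fun j => lam (blk j) * h α j

/-- Admissible cross-section parameterisation of the positive flux cone: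
`Y` is an open bounded convex set (an open polytope), `h` is affine and injective,
depends blockwise on the coordinates of `Y`, and `(λ, α) ↦ (1_P λ) ∘ h(α)` is a
bijection from `ℝ^p_+ × Y` onto the positive flux cone. -/
def admissibleH {n m p d : ℕ} (Γ : Matrix (Fin n) (Fin m) ℤ) (blk : Fin m → Fin p)
    (Y : Set (Fin d → ℝ)) (h : (Fin d → ℝ) → (Fin m → ℝ)) : Prop :=
  IsOpen Y ∧ Convex ℝ Y ∧ Bornology.IsBounded Y ∧ Y.Nonempty ∧
  (∃ (L : (Fin d → ℝ) →ₗ[ℝ] (Fin m → ℝ)) (c : Fin m → ℝ), ∀ α, h α = L α + c) ∧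
  (∃ bY : Fin d → Fin p, ∀ (α α' : Fin d → ℝ) (j : Fin m),
      (∀ t, bY t = blk j → α t = α' t) → h α j = h α' j) ∧
  (∀ (lam : Fin p → ℝ) (α : Fin d → ℝ), (∀ i, 0 < lam i) → α ∈ Y →
      (mR Γ).mulVec (fluxParam blk h lam α) = 0 ∧ ∀ j, 0 < fluxParam blk h lam α j) ∧
  (∀ v : Fin m → ℝ, (mR Γ).mulVec v = 0 → (∀ j, 0 < v j) →
      ∃ (lam : Fin p → ℝ) (α : Fin d → ℝ), (∀ i, 0 < lam i) ∧ α ∈ Y ∧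
        v = fluxParam blk h lam α) ∧
  (∀ (lam lam' : Fin p → ℝ) (α α' : Fin d → ℝ), (∀ i, 0 < lam i) → (∀ i, 0 < lam' i) →
      α ∈ Y → α' ∈ Y → fluxParam blk h lam α = fluxParam blk h lam' α' →
      lam = lam' ∧ α = α')

/-- The solvability variety `A_κ = {α ∈ Y : h(α)^W = κ^W}`. -/
def Aset {m d w : ℕ} (W : Matrix (Fin w) (Fin m) ℝ) (Y : Set (Fin d → ℝ))
    (h : (Fin d → ℝ) → (Fin m → ℝ)) (κ : Fin m → ℝ) : Set (Fin d → ℝ) :=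
  {α ∈ Y | powVec W (h α) = powVec W κ}

/-- The rows of `W` form a basis of `ker [A|1_P]ᵀ`. -/
def isSolvabilityMatrix {n m p w : ℕ} (A : Matrix (Fin m) (Fin n) ℤ) (blk : Fin m → Fin p)
    (W : Matrix (Fin w) (Fin m) ℝ) : Prop :=
  W * srcMat A blk = 0 ∧ W.rank = w ∧ w + (srcMat A blk).rank = m

/-- The columns of `Q` form a basis of `ker [A|1_P]`. -/
def isKernelMatrix {n m p q : ℕ} (A : Matrix (Fin m) (Fin n) ℤ) (blk : Fin m → Fin p)
    (Q : Matrix (Fin (n + p)) (Fin q) ℝ) : Prop :=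
  srcMat A blk * Q = 0 ∧ Q.rank = q ∧ (srcMat A blk).rank + q = n + p

/-- `G` is a generalised inverse of `[A|1_P]`. -/
def isGenInv {n m p : ℕ} (A : Matrix (Fin m) (Fin n) ℤ) (blk : Fin m → Fin p)
    (G : Matrix (Fin (n + p)) (Fin m) ℝ) : Prop :=
  srcMat A blk * G * srcMat A blk = srcMat A blk

/-- The parameterising map `F_κ(α,μ) = (h(α)/κ)^Ĝ ∘ μ^Q̂`. -/
def Fmap {n m p d q : ℕ} (G : Matrix (Fin (n + p)) (Fin m) ℝ)
    (Q : Matrix (Fin (n + p)) (Fin q) ℝ)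
    (h : (Fin d → ℝ) → (Fin m → ℝ)) (κ : Fin m → ℝ) :
    (Fin d → ℝ) × (Fin q → ℝ) → (Fin n → ℝ) :=
  fun z => powVec (topRows n p G) (h z.1 / κ) * powVec (topRows n p Q) z.2


/-- `A_κ` is finite for all rate constants in a nonempty Zariski-open subset of `ℝ^m_+`. -/
def genericallyFiniteAset {m d w : ℕ} (W : Matrix (Fin w) (Fin m) ℝ)
    (Y : Set (Fin d → ℝ)) (h : (Fin d → ℝ) → (Fin m → ℝ)) : Prop :=
  ∃ F : MvPolynomial (Fin m) ℝ,
    (∃ κ ∈ posOrth m, MvPolynomial.eval κ F ≠ 0) ∧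
    ∀ κ ∈ posOrth m, MvPolynomial.eval κ F ≠ 0 → (Aset W Y h κ).Finite

theorem alg_super {σ : Type} [Fintype σ] {m : ℕ} (f : Fin m → MvPolynomial σ ℝ)
    (hf : AlgebraicIndependent ℝ f) :
    ∃ B : Set (MvPolynomial σ ℝ), Set.range f ⊆ B ∧ B.Finite ∧ B.ncard = Fintype.card σ ∧
      IsTranscendenceBasis ℝ ((↑) : B → MvPolynomial σ ℝ) := by
  obtain ⟨B, hB, hT⟩ := exists_isTranscendenceBasis_superset (R := ℝ)
    (s := Set.range f) hf.coe_range
  have h1 := hT.cardinalMk_eq_trdeg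
  rw [MvPolynomial.trdeg_of_isDomain] at h1
  simp only [Cardinal.lift_id, Cardinal.mk_fintype] at h1
  have hfin : B.Finite := by
    rw [← Set.finite_coe_iff, ← Cardinal.lt_aleph0_iff_finite, h1]
    exact Cardinal.natCast_lt_aleph0
  refine ⟨B, hB, hfin, ?_, hT⟩
  rw [Set.ncard_def, Set.encard, ENat.card, h1]
  simp

theorem alg_range {σ : Type} [Fintype σ] {m : ℕ} (f : Fin m → MvPolynomial σ ℝ)
    (hf : AlgebraicIndependent ℝ f) (hle : Fintype.card σ ≤ m) (y : MvPolynomial σ ℝ) :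
    ∃ Q : Polynomial (MvPolynomial (Fin m) ℝ), Q ≠ 0 ∧
      Polynomial.eval₂ (MvPolynomial.aeval (R := ℝ) f).toRingHom y Q = 0 := by
  obtain ⟨B, hB, hfin, hc, hT⟩ := alg_super f hf
  have hr : (Set.range f).ncard = m := by
    rw [← Set.image_univ, Set.ncard_image_of_injective _ hf.injective, Set.ncard_univ]; simp
  have hBeq : Set.range f = B := Set.eq_of_subset_of_ncard_le hB (by omega) hfin
  have halg := hT.isAlgebraic
  rw [Subtype.range_coe, ← hBeq] at halg
  obtain ⟨P, hP0, hP⟩ := halg.isAlgebraic y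
  refine ⟨P.map (hf.aevalEquiv.symm : _ →+* MvPolynomial (Fin m) ℝ), ?_, ?_⟩
  · rw [Ne, Polynomial.map_eq_zero_iff]
    · exact hP0
    · exact hf.aevalEquiv.symm.injective
  · rw [Polynomial.eval₂_map, ← hP, Polynomial.aeval_def]
    congr 1
    ext a
    exact congrArg _ (hf.aeval_repr a)

theorem gen_fin {σ : Type} [Fintype σ] {m : ℕ} (f : Fin m → MvPolynomial σ ℝ)
    (hle : Fintype.card σ ≤ m) :
    ∃ F : MvPolynomial (Fin m) ℝ, F ≠ 0 ∧ ∀ κ, MvPolynomial.eval κ F ≠ 0 →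
      {z : σ → ℝ | ∀ j, MvPolynomial.eval z (f j) = κ j}.Finite := by
  by_cases hf : AlgebraicIndependent ℝ f
  · choose Q hQ0 hQ using fun t : σ => alg_range f hf hle (MvPolynomial.X t)
    refine ⟨∏ t, (Q t).leadingCoeff, ?_, ?_⟩
    · rw [Finset.prod_ne_zero_iff]
      intro t _
      exact Polynomial.leadingCoeff_ne_zero.mpr (hQ0 t)
    · intro κ hκ
      rw [map_prod, Finset.prod_ne_zero_iff] at hκ
      have hq : ∀ t, (Q t).map (MvPolynomial.eval κ) ≠ 0 := by
        intro t h0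
        apply hκ t (Finset.mem_univ _)
        have := congrArg (fun P => Polynomial.coeff P (Q t).natDegree) h0
        simpa [Polynomial.coeff_map] using this
      refine (Set.Finite.pi' (t := fun t => {x : ℝ | ((Q t).map (MvPolynomial.eval κ)).IsRoot x})
        fun t => Polynomial.finite_setOfPred_isRoot (hq t)).subset ?_
      intro z hz t
      have h1 := congrArg (MvPolynomial.eval z) (hQ t)
      rw [Polynomial.hom_eval₂] at h1
      simp only [Set.mem_ofPred_eq, Polynomial.IsRoot.def, Polynomial.eval_map]
      rw [map_zero, MvPolynomial.eval_X] at h1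
      rw [← h1]
      congr 1
      ext i
      · simp
      · simp [← hz i]
  · rw [algebraicIndependent_iff] at hf
    push Not at hf
    obtain ⟨F, hF, hF0⟩ := hf
    refine ⟨F, hF0, fun κ hκ => ?_⟩
    convert Set.finite_empty
    ext z
    simp only [Set.mem_ofPred_eq, Set.mem_empty_iff_false, iff_false]
    intro hz
    apply hκ
    have h1 := congrArg (MvPolynomial.eval z) hF
    rw [map_zero, ← MvPolynomial.coe_aeval_eq_eval] at h1
    rw [← h1, ← MvPolynomial.coe_aeval_eq_eval]
    change _ = (MvPolynomial.aeval z) ((MvPolynomial.aeval f) F)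
    rw [← AlgHom.comp_apply, MvPolynomial.comp_aeval]
    have : κ = fun i => (MvPolynomial.aeval z) (f i) := by
      ext i; rw [← hz i]; rfl
    rw [this]; rfl

theorem derivation_zero_of_alg {A K : Type} [CommRing A] [IsDomain A] [Algebra ℝ A] [Field K] [Algebra A K]
    [FaithfulSMul A K] [Algebra ℝ K] [IsScalarTower ℝ A K]
    (B : Set A) (D : Derivation ℝ A K) (hB : ∀ b ∈ B, D b = 0)
    (halg : Algebra.IsAlgebraic (Algebra.adjoin ℝ B) A) (y : A) : D y = 0 := by
  have hD0 : ∀ a ∈ Algebra.adjoin ℝ B, D a = 0 := by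
    intro a ha
    induction ha using Algebra.adjoin_induction with
    | mem x hx => exact hB x hx
    | algebraMap r => simp
    | add x y _ _ hx hy => simp [hx, hy]
    | mul x y _ _ hx hy => simp [hx, hy]
  let D' : Derivation (Algebra.adjoin ℝ B) A K :=
    Derivation.mk' { toFun := D, map_add' := D.map_add, map_smul' := fun r a => by
                       rw [Algebra.smul_def, D.leibniz]
                       have : D (algebraMap (Algebra.adjoin ℝ B) A r) = 0 := hD0 _ r.2
                       rw [this, smul_zero, add_zero]; rfl }
      (fun a b => D.leibniz a b)
  have key : ∀ N : ℕ, ∀ P : Polynomial (Algebra.adjoin ℝ B), P.natDegree ≤ N → P ≠ 0 →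
      Polynomial.aeval y P = 0 → D y = 0 := by
    intro N
    induction N with
    | zero =>
      intro P hP hP0 hy
      exfalso
      rw [Polynomial.eq_C_of_natDegree_le_zero hP, Polynomial.aeval_C] at hy
      have : P.coeff 0 = 0 := Subtype.ext hy
      apply hP0
      rw [Polynomial.eq_C_of_natDegree_le_zero hP, this, Polynomial.C_0]
    | succ N ih =>
      intro P hP hP0 hy
      by_cases hd : P.natDegree = 0
      · exact ih P (by omega) hP0 hy
      by_cases h1 : Polynomial.aeval y (Polynomial.derivative P) = 0
      · refine ih _ ?_ ?_ h1
        · have := Polynomial.natDegree_derivative_lt hd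
          omega
        · intro h2
          haveI : CharZero (Algebra.adjoin ℝ B) :=
            charZero_of_injective_algebraMap (algebraMap ℝ (Algebra.adjoin ℝ B)).injective
          exact hd (Polynomial.derivative_eq_zero.mp h2)
      · have h2 := D'.map_aeval P y
        rw [hy, map_zero] at h2
        rw [Algebra.smul_def] at h2
        rcases mul_eq_zero.mp h2.symm with h3 | h3
        · exact absurd ((FaithfulSMul.algebraMap_eq_zero_iff A K).mp h3) h1
        · exact h3
  obtain ⟨P, hP0, hP⟩ := halg.isAlgebraic y
  exact key _ P le_rfl hP0 hP

theorem exists_deriv {σ : Type} [Fintype σ] {m : ℕ} (f : Fin m → MvPolynomial σ ℝ)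
    (hf : AlgebraicIndependent ℝ f) (j : Fin m) :
    ∃ (D : Derivation ℝ (MvPolynomial σ ℝ) (MvPolynomial σ ℝ)) (g : MvPolynomial σ ℝ),
      g ≠ 0 ∧ ∀ i, D (f i) = if i = j then g else 0 := by
  classical
  obtain ⟨B, hB, hfin, hc, hT⟩ := alg_super f hf
  have halg := hT.isAlgebraic
  rw [Subtype.range_coe] at halg
  let K := FractionRing (MvPolynomial σ ℝ)
  have : Fintype B := hfin.fintype
  let Φ : (σ → K) →ₗ[K] (B → K) :=
    { toFun := fun u b => MvPolynomial.mkDerivation ℝ u (b : MvPolynomial σ ℝ)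
      map_add' := fun u v => by
        ext b
        have : MvPolynomial.mkDerivation ℝ (u + v) =
          MvPolynomial.mkDerivation ℝ u + MvPolynomial.mkDerivation ℝ v := by
          apply MvPolynomial.derivation_ext
          intro i
          simp [MvPolynomial.mkDerivation_X]
        simp [this]
      map_smul' := fun c u => by
        ext b
        have : MvPolynomial.mkDerivation ℝ (c • u) =
          c • MvPolynomial.mkDerivation ℝ u := by
          apply MvPolynomial.derivation_ext
          intro i
          simp [MvPolynomial.mkDerivation_X]
        simp [this] }
  have hinj : Function.Injective Φ := by
    rw [← LinearMap.ker_eq_bot, LinearMap.ker_eq_bot']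
    intro u hu
    ext t
    have := derivation_zero_of_alg (K := K) B (MvPolynomial.mkDerivation ℝ u)
      (fun b hb => congrFun hu ⟨b, hb⟩) halg (MvPolynomial.X t)
    rw [MvPolynomial.mkDerivation_X] at this
    exact this
  have hsurj : Function.Surjective Φ := by
    rw [← LinearMap.injective_iff_surjective_of_finrank_eq_finrank]
    · exact hinj
    · rw [Module.finrank_fintype_fun_eq_card, Module.finrank_fintype_fun_eq_card, ← hc,
        ← Nat.card_coe_set_eq, Nat.card_eq_fintype_card]
  obtain ⟨u, hu⟩ := hsurj (fun b => if (b : MvPolynomial σ ℝ) = f j then 1 else 0)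
  obtain ⟨g, hg⟩ := IsLocalization.exist_integer_multiples_of_finite
    (nonZeroDivisors (MvPolynomial σ ℝ)) u
  choose P hP using hg
  refine ⟨MvPolynomial.mkDerivation ℝ P, g, nonZeroDivisors.ne_zero g.2, fun i => ?_⟩
  apply FaithfulSMul.algebraMap_injective (MvPolynomial σ ℝ) K
  have h1 : ∀ q, algebraMap (MvPolynomial σ ℝ) K (MvPolynomial.mkDerivation ℝ P q) =
      (g : MvPolynomial σ ℝ) • MvPolynomial.mkDerivation ℝ u q := by
    intro q
    have : (LinearMap.compDer (Algebra.linearMap (MvPolynomial σ ℝ) K)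
        (MvPolynomial.mkDerivation ℝ P)) =
        (g : MvPolynomial σ ℝ) • MvPolynomial.mkDerivation ℝ u := by
      apply MvPolynomial.derivation_ext
      intro s
      simpa [MvPolynomial.mkDerivation_X] using hP s
    exact congrArg (fun D => D q) this
  rw [h1]
  have h2 := congrFun hu ⟨f i, hB ⟨i, rfl⟩⟩
  have h3 : (MvPolynomial.mkDerivation ℝ u) (f i) = if f i = f j then 1 else 0 := h2
  rw [h3]
  by_cases hij : i = j
  · simp [hij, Algebra.smul_def]
  · simp [hij, hf.injective.ne hij]

theorem exists_pt {σ : Type} [Fintype σ] (F : MvPolynomial σ ℝ) (hF : F ≠ 0)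
    (U : Set (σ → ℝ)) (hU : IsOpen U) (hne : U.Nonempty) :
    ∃ z ∈ U, MvPolynomial.eval z F ≠ 0 := by
  by_contra! hcon
  obtain ⟨z, hz⟩ := hne
  obtain ⟨ε, hε, hb⟩ := Metric.isOpen_iff.mp hU z hz
  apply hF
  apply MvPolynomial.funext_set (fun i => Metric.ball (z i) ε)
  · intro i
    exact infinite_of_mem_nhds (z i) (Metric.ball_mem_nhds _ hε)
  · intro x hx
    rw [map_zero]
    apply hcon x (hb _)
    rw [Metric.mem_ball, dist_pi_lt_iff hε]
    intro i
    exact hx i trivial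

theorem open_fibre {d w : ℕ} (φ : (Fin d → ℝ) → (Fin w → ℝ))
    (φ' : (Fin d → ℝ) →L[ℝ] (Fin w → ℝ)) (a : Fin d → ℝ) (hφ : HasStrictFDerivAt φ φ' a)
    (hs : Function.Surjective φ') (hlt : w < d) (U : Set (Fin d → ℝ)) (hU : U ∈ nhds a) :
    ∀ᶠ b in nhds (φ a), {x | x ∈ U ∧ φ x = b}.Infinite := by
  obtain ⟨v, hv, hv0⟩ : ∃ v, φ' v = 0 ∧ v ≠ 0 := by
    have h1 : ¬ Function.Injective φ'.toLinearMap := by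
      intro hi
      have := LinearMap.finrank_le_finrank_of_injective hi
      simp at this
      omega
    rw [← LinearMap.ker_eq_bot, LinearMap.ker_eq_bot'] at h1
    push Not at h1
    exact h1
  obtain ⟨t, ht⟩ := Function.ne_iff.mp hv0
  simp only [Pi.zero_apply] at ht
  have h2 := hφ.prodMk (ContinuousLinearMap.proj (R := ℝ) (φ := fun _ : Fin d => ℝ) t).hasStrictFDerivAt
  have h3 := h2.map_nhds_eq_of_surj (by
    rw [LinearMap.range_eq_top]
    rintro ⟨b, c⟩
    obtain ⟨u, hu⟩ := hs b
    refine ⟨u + ((c - u t) / v t) • v, ?_⟩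
    simp [hu, hv, ht])
  have h4 := Filter.image_mem_map (m := fun x => (φ x, (ContinuousLinearMap.proj (R := ℝ) (φ := fun _ : Fin d => ℝ) t) x)) hU
  rw [h3, nhds_prod_eq, Filter.mem_prod_iff] at h4
  obtain ⟨V1, hV1, V2, hV2, hV⟩ := h4
  filter_upwards [hV1] with b hb
  apply Set.Infinite.of_image (fun x => x t)
  apply (infinite_of_mem_nhds _ hV2).mono
  intro s hs
  obtain ⟨x, hx, hxe⟩ := hV (Set.mk_mem_prod hb hs)
  simp only [Prod.mk.injEq] at hxe
  exact ⟨x, ⟨hx, hxe.1⟩, hxe.2⟩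

theorem powVec_exp {k l : ℕ} (M : Matrix (Fin k) (Fin l) ℝ) (x : Fin l → ℝ) (hx : ∀ j, 0 < x j)
    (i : Fin k) : powVec M x i = Real.exp (∑ j, M i j * Real.log (x j)) := by
  rw [powVec, Real.exp_sum]
  refine Finset.prod_congr rfl fun j _ => ?_
  rw [Real.rpow_def_of_pos (hx j), mul_comm]

theorem powVec_eq_iff {k l : ℕ} (M : Matrix (Fin k) (Fin l) ℝ) (x y : Fin l → ℝ)
    (hx : ∀ j, 0 < x j) (hy : ∀ j, 0 < y j) :
    powVec M x = powVec M y ↔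
      M.mulVec (fun j => Real.log (x j)) = M.mulVec (fun j => Real.log (y j)) := by
  constructor
  · intro hh
    ext i
    have := congrFun hh i
    rw [powVec_exp _ _ hx, powVec_exp _ _ hy, Real.exp_eq_exp] at this
    exact this
  · intro hh
    ext i
    rw [powVec_exp _ _ hx, powVec_exp _ _ hy, Real.exp_eq_exp]
    exact congrFun hh i

theorem src_mulVec {n m p : ℕ} (A : Matrix (Fin m) (Fin n) ℤ) (blk : Fin m → Fin p)
    (u : Fin (n + p) → ℝ) (j : Fin m) :
    (srcMat A blk).mulVec u j = (mR A).mulVec (fun k => u (Fin.castAdd p k)) j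
      + u (Fin.natAdd n (blk j)) := by
  simp [Matrix.mulVec, dotProduct, srcMat, mR, Fin.sum_univ_add]

/-- Linear data extracted from an admissible parameterisation. -/
structure LinData {n m p d : ℕ} (Γ : Matrix (Fin n) (Fin m) ℤ) (blk : Fin m → Fin p)
    (Y : Set (Fin d → ℝ)) (h : (Fin d → ℝ) → (Fin m → ℝ))
    (L : (Fin d → ℝ) →ₗ[ℝ] (Fin m → ℝ)) (c : Fin m → ℝ) (bY : Fin d → Fin p) : Prop where
  op : IsOpen Y
  ne : Y.Nonempty
  aff : ∀ α, h α = L α + c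
  pos : ∀ α ∈ Y, ∀ j, 0 < h α j
  blockL : ∀ (μ : Fin p → ℝ) (δ : Fin d → ℝ) (j : Fin m),
    L (fun t => μ (bY t) * δ t) j = μ (blk j) * L δ j
  kerL : ∀ δ, (mR Γ).mulVec (L δ) = 0
  kerB : ∀ α ∈ Y, ∀ μ : Fin p → ℝ, (mR Γ).mulVec (fun j => μ (blk j) * h α j) = 0
  surj : ∀ v : Fin m → ℝ, (mR Γ).mulVec v = 0 → (∀ j, 0 < v j) →
      ∃ (lam : Fin p → ℝ) (α : Fin d → ℝ), (∀ i, 0 < lam i) ∧ α ∈ Y ∧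
        v = fluxParam blk h lam α

theorem exists_linData {n m p d : ℕ} (Γ : Matrix (Fin n) (Fin m) ℤ) (blk : Fin m → Fin p)
    (Y : Set (Fin d → ℝ)) (h : (Fin d → ℝ) → (Fin m → ℝ)) (hadm : admissibleH Γ blk Y h) :
    ∃ L c bY, LinData Γ blk Y h L c bY := by
  obtain ⟨hop, -, -, hne, ⟨L, c, haff⟩, ⟨bY, hbY⟩, hflux, hsurj, -⟩ := hadm
  have hone : ∀ α ∈ Y, (mR Γ).mulVec (h α) = 0 ∧ ∀ j, 0 < h α j := by
    intro α hα
    have := hflux (fun _ => 1) α (fun _ => one_pos) hα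
    have he : fluxParam blk h (fun _ => 1) α = h α := by
      ext j; simp [fluxParam]
    rwa [he] at this
  refine ⟨L, c, bY, hop, hne, haff, fun α hα => (hone α hα).2, ?_, ?_, ?_, hsurj⟩
  · intro μ δ j
    have := hbY (fun t => μ (bY t) * δ t) (μ (blk j) • δ) j (by
      intro t ht; simp [ht])
    rw [haff, haff, map_smul] at this
    simpa using this
  · intro δ
    obtain ⟨α, hα⟩ := hne
    have hc : Filter.Tendsto (fun ε : ℝ => α + ε • δ) (nhds 0) (nhds α) := by
      have : Continuous (fun ε : ℝ => α + ε • δ) := by fun_prop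
      simpa using this.tendsto 0
    have hev : ∀ᶠ ε in nhdsWithin (0:ℝ) (Set.Ioi 0), α + ε • δ ∈ Y :=
      nhdsWithin_le_nhds (hc (hop.mem_nhds hα))
    obtain ⟨ε, hε, hε0⟩ := (hev.and self_mem_nhdsWithin).exists
    have h1 := (hone _ hε).1
    have h2 := (hone _ hα).1
    have h3 : h (α + ε • δ) = h α + ε • L δ := by
      rw [haff, haff, map_add, map_smul]; abel
    rw [h3, Matrix.mulVec_add, h2, zero_add, Matrix.mulVec_smul] at h1
    exact (smul_eq_zero.mp h1).resolve_left (ne_of_gt hε0)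
  · intro α hα μ
    have h1 := (hflux (fun i => |μ i| + 1) α (fun i => by positivity) hα).1
    have h2 := (hflux (fun i => |μ i| + 1 - μ i) α
      (fun i => by have := le_abs_self (μ i); linarith) hα).1
    have h3 : (fun j => μ (blk j) * h α j) = fluxParam blk h (fun i => |μ i| + 1) α -
        fluxParam blk h (fun i => |μ i| + 1 - μ i) α := by
      ext j; simp only [fluxParam, Pi.sub_apply]; ring
    rw [h3, Matrix.mulVec_sub, h1, h2, sub_zero]

theorem decomp {n m p d : ℕ} {Γ : Matrix (Fin n) (Fin m) ℤ} {blk : Fin m → Fin p}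
    {Y : Set (Fin d → ℝ)} {h : (Fin d → ℝ) → (Fin m → ℝ)}
    {L : (Fin d → ℝ) →ₗ[ℝ] (Fin m → ℝ)} {c : Fin m → ℝ} {bY : Fin d → Fin p}
    (H : LinData Γ blk Y h L c bY) (lam : Fin p → ℝ) (α : Fin d → ℝ) (hlam : ∀ i, 0 < lam i)
    (hα : α ∈ Y) (u : Fin m → ℝ) (hu : (mR Γ).mulVec u = 0) :
    ∃ (μ : Fin p → ℝ) (δ : Fin d → ℝ), ∀ j,
      u j = fluxParam blk h lam α j * μ (blk j) + L δ j := by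
  have hev : ∀ᶠ ε in nhdsWithin (0:ℝ) (Set.Ioi 0), ∀ j, 0 < fluxParam blk h lam α j + ε * u j := by
    rw [Filter.eventually_all]
    intro j
    apply nhdsWithin_le_nhds
    have hc : Continuous (fun ε : ℝ => fluxParam blk h lam α j + ε * u j) := by fun_prop
    refine (hc.tendsto 0).eventually (lt_mem_nhds ?_)
    simp only [zero_mul, add_zero]
    exact mul_pos (hlam _) (H.pos α hα j)
  obtain ⟨ε, hε, hε0⟩ := (hev.and self_mem_nhdsWithin).exists
  have hε0' : ε ≠ 0 := ne_of_gt hε0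
  obtain ⟨lam', α', hlam', hα', hv⟩ := H.surj (fluxParam blk h lam α + ε • u) (by
    rw [Matrix.mulVec_add, Matrix.mulVec_smul, hu, smul_zero, add_zero]
    exact H.kerB α hα lam) hε
  refine ⟨fun i => (lam' i / lam i - 1) / ε, fun t => (lam' (bY t) / ε) * (α' - α) t, fun j => ?_⟩
  have h1 := congrFun hv j
  have h2 := H.blockL (fun i => lam' i / ε) (α' - α) j
  rw [h2, map_sub]
  simp only [fluxParam, H.aff, Pi.add_apply, Pi.smul_apply, smul_eq_mul, Pi.sub_apply] at h1 ⊢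
  have := (hlam (blk j)).ne'
  field_simp
  linarith

theorem key1 {n m p d w : ℕ} {Γ : Matrix (Fin n) (Fin m) ℤ} {A : Matrix (Fin m) (Fin n) ℤ}
    {blk : Fin m → Fin p}
    {Y : Set (Fin d → ℝ)} {h : (Fin d → ℝ) → (Fin m → ℝ)}
    {L : (Fin d → ℝ) →ₗ[ℝ] (Fin m → ℝ)} {c : Fin m → ℝ} {bY : Fin d → Fin p}
    (H : LinData Γ blk Y h L c bY)
    {W : Matrix (Fin w) (Fin m) ℝ} (hW : isSolvabilityMatrix A blk W)
    (hsd : ¬ stronglyDegenerate Γ A) :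
    ∃ α ∈ Y, ∀ b : Fin w → ℝ, ∃ δ, W.mulVec (fun j => L δ j / h α j) = b := by
  unfold stronglyDegenerate at hsd
  push Not at hsd
  obtain ⟨κ, hκ, x, ⟨hx, hx0⟩, hr⟩ := hsd
  set v := κ * powVec (mR A) x with hv
  have hvpos : ∀ j, 0 < v j := by
    intro j
    rw [hv, Pi.mul_apply, powVec_exp _ _ hx]
    exact mul_pos (hκ j) (Real.exp_pos _)
  obtain ⟨lam, α, hlam, hα, hva⟩ := H.surj v hx0 hvpos
  refine ⟨α, hα, fun b => ?_⟩
  -- surjectivity of W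
  have hWs : Function.Surjective W.mulVecLin := by
    rw [← LinearMap.range_eq_top]
    apply Submodule.eq_top_of_finrank_eq
    have := hW.2.1
    rw [Matrix.rank] at this
    rw [this]; simp
  obtain ⟨a, ha⟩ := hWs b
  rw [Matrix.mulVecLin_apply] at ha
  have hJ : ∀ u, jacMat Γ A κ x *ᵥ u =
      (mR Γ).mulVec (fun j => v j * (mR A).mulVec (fun i => (x i)⁻¹ * u i) j) := by
    intro u
    rw [jacMat, ← Matrix.mulVec_mulVec, ← Matrix.mulVec_mulVec, ← Matrix.mulVec_mulVec]
    congr 1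
    ext j
    rw [Matrix.mulVec_diagonal]
    congr 2
    ext i
    rw [Matrix.mulVec_diagonal]
  have hrange : LinearMap.range (jacMat Γ A κ x).mulVecLin = LinearMap.range (mR Γ).mulVecLin := by
    apply Submodule.eq_of_le_of_finrank_le
    · rintro _ ⟨u, rfl⟩
      rw [Matrix.mulVecLin_apply, hJ]
      exact ⟨_, rfl⟩
    · exact hr
  obtain ⟨u, hu⟩ : (mR Γ).mulVec (fun j => v j * a j) ∈
      LinearMap.range (jacMat Γ A κ x).mulVecLin := by
    rw [hrange]; exact ⟨_, rfl⟩
  rw [Matrix.mulVecLin_apply, hJ] at hu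
  set z : Fin n → ℝ := fun i => (x i)⁻¹ * u i with hz
  obtain ⟨μ, δ, hd⟩ := decomp H lam α hlam hα (fun j => v j * (a j - (mR A).mulVec z j)) (by
    have : (fun j => v j * (a j - (mR A).mulVec z j)) =
      (fun j => v j * a j) - (fun j => v j * (mR A).mulVec z j) := by
      ext j; simp only [Pi.sub_apply]; ring
    rw [this, Matrix.mulVec_sub, hu, sub_self])
  refine ⟨fun t => (lam (bY t))⁻¹ * δ t, ?_⟩
  have h1 : a = (fun j => L (fun t => (lam (bY t))⁻¹ * δ t) j / h α j) +
      (srcMat A blk).mulVec (Fin.append z μ) := by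
    ext j
    have h2 := hd j
    rw [← hva] at h2
    rw [Pi.add_apply, src_mulVec, H.blockL (fun i => (lam i)⁻¹)]
    simp only [Fin.append_left, Fin.append_right]
    have h3 : v j = lam (blk j) * h α j := congrFun hva j
    have h4 := (hlam (blk j)).ne'
    have h5 := (H.pos α hα j).ne'
    rw [h3] at h2
    field_simp
    have e : (fun k => z k) = z := rfl
    linear_combination h2
  rw [← ha, h1, Matrix.mulVec_add, Matrix.mulVec_mulVec, hW.1, Matrix.zero_mulVec, add_zero]

theorem key2 {n m p d : ℕ} {Γ : Matrix (Fin n) (Fin m) ℤ} {A : Matrix (Fin m) (Fin n) ℤ}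
    {blk : Fin m → Fin p}
    {Y : Set (Fin d → ℝ)} {h : (Fin d → ℝ) → (Fin m → ℝ)}
    {L : (Fin d → ℝ) →ₗ[ℝ] (Fin m → ℝ)} {c : Fin m → ℝ} {bY : Fin d → Fin p}
    (H : LinData Γ blk Y h L c bY) (α : Fin d → ℝ) (hα : α ∈ Y)
    (hs : ∀ a : Fin m → ℝ, ∃ δ u, ∀ j, a j = L δ j / h α j + (srcMat A blk).mulVec u j) :
    ¬ stronglyDegenerate Γ A := by
  intro hsd
  have h1 : powVec (mR A) (fun _ => 1) = 1 := by
    ext i; simp [powVec]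
  have hG : (mR Γ).mulVec (h α) = 0 := by
    simpa using H.kerB α hα (fun _ => 1)
  have h2 := hsd (h α) (H.pos α hα) (fun _ => 1) ⟨fun _ => one_pos, by
    rw [massAction, h1, mul_one, hG]⟩
  have hJ : ∀ u, jacMat Γ A (h α) (fun _ => 1) *ᵥ u =
      (mR Γ).mulVec (fun j => h α j * (mR A).mulVec u j) := by
    intro u
    rw [jacMat, ← Matrix.mulVec_mulVec, ← Matrix.mulVec_mulVec, ← Matrix.mulVec_mulVec, h1, mul_one]
    congr 1
    ext j
    rw [Matrix.mulVec_diagonal]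
    congr 2
    ext i
    rw [Matrix.mulVec_diagonal]
    simp
  refine absurd (Submodule.finrank_mono (s := LinearMap.range (mR Γ).mulVecLin)
    (t := LinearMap.range (jacMat Γ A (h α) (fun _ => 1)).mulVecLin) ?_) (not_le.mpr h2)
  rintro _ ⟨y, rfl⟩
  obtain ⟨δ, u, hu⟩ := hs (fun j => y j / h α j)
  refine ⟨fun k => u (Fin.castAdd p k), ?_⟩
  rw [Matrix.mulVecLin_apply, Matrix.mulVecLin_apply, hJ]
  have h3 : y = L δ + (fun j => h α j * (mR A).mulVec (fun k => u (Fin.castAdd p k)) j) +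
      (fun j => u (Fin.natAdd n (blk j)) * h α j) := by
    ext j
    have h5 := (H.pos α hα j).ne'
    have h4 := hu j
    rw [src_mulVec] at h4
    simp only [Pi.add_apply]
    field_simp at h4
    linear_combination h4
  conv_rhs => rw [h3]
  rw [Matrix.mulVec_add, Matrix.mulVec_add, H.kerL, zero_add,
    H.kerB α hα (fun i => u (Fin.natAdd n i)), add_zero]

theorem exists_cols {a b : ℕ} (M : Matrix (Fin a) (Fin b) ℝ) :
    ∃ (S : Type) (_ : Fintype S) (e : S → Fin b), Fintype.card S = M.rank ∧
      ∀ u, ∃ c : S → ℝ, ∀ j, M.mulVec u j = ∑ s, M j (e s) * c s := by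
  obtain ⟨S, e, he, hspan, hli⟩ := exists_linearIndependent' ℝ M.col
  haveI : Fintype S := Fintype.ofInjective e he
  refine ⟨S, inferInstance, e, ?_, fun u => ?_⟩
  · rw [Matrix.rank_eq_finrank_span_cols, ← hspan, finrank_span_eq_card hli]
  · have h1 : M.mulVec u ∈ Submodule.span ℝ (Set.range (M.col ∘ e)) := by
      rw [hspan, ← Matrix.range_mulVecLin]
      exact ⟨u, rfl⟩
    rw [Submodule.mem_span_range_iff_exists_fun] at h1
    obtain ⟨c, hc⟩ := h1
    refine ⟨c, fun j => ?_⟩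
    rw [← hc]
    simp only [Finset.sum_apply, Pi.smul_apply, smul_eq_mul]
    exact Finset.sum_congr rfl fun s _ => mul_comm _ _

/-- Natural number exponents of `[A | 1_P]`. -/
def expo {n m p : ℕ} (A : Matrix (Fin m) (Fin n) ℤ) (blk : Fin m → Fin p) (j : Fin m)
    (k : Fin (n + p)) : ℕ :=
  Fin.append (fun k => (A j k).toNat) (fun i => if blk j = i then 1 else 0) k

theorem expo_cast {n m p : ℕ} (A : Matrix (Fin m) (Fin n) ℤ) (hA : ∀ i j, 0 ≤ A i j)
    (blk : Fin m → Fin p) (j : Fin m) (k : Fin (n + p)) :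
    (expo A blk j k : ℝ) = srcMat A blk j k := by
  refine Fin.addCases (fun i => ?_) (fun i => ?_) k
  · simp only [expo, srcMat, Fin.append_left, Matrix.of_apply]
    have := Int.toNat_of_nonneg (hA j i)
    exact_mod_cast this
  · simp [expo, srcMat]

/-- The polynomial `h_j(α) * y^{S-columns}`. -/
def fpoly {n m p d : ℕ} (A : Matrix (Fin m) (Fin n) ℤ) (blk : Fin m → Fin p)
    (L : (Fin d → ℝ) →ₗ[ℝ] (Fin m → ℝ)) (c : Fin m → ℝ) {S : Type} [Fintype S]
    (e : S → Fin (n + p)) (j : Fin m) : MvPolynomial (Fin d ⊕ S) ℝ :=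
  (∑ t, MvPolynomial.C (L (Pi.single t 1) j) * MvPolynomial.X (Sum.inl t) + MvPolynomial.C (c j)) *
    ∏ s, MvPolynomial.X (Sum.inr s) ^ expo A blk j (e s)

theorem L_sum {m d : ℕ} (L : (Fin d → ℝ) →ₗ[ℝ] (Fin m → ℝ)) (δ : Fin d → ℝ) (j : Fin m) :
    L δ j = ∑ t, L (Pi.single t 1) j * δ t := by
  conv_lhs => rw [pi_eq_sum_univ' δ, map_sum]
  rw [Finset.sum_apply]
  refine Finset.sum_congr rfl fun t _ => ?_
  rw [map_smul, Pi.smul_apply, smul_eq_mul, mul_comm]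

theorem fpoly_eval {n m p d : ℕ} (A : Matrix (Fin m) (Fin n) ℤ) (blk : Fin m → Fin p)
    (L : (Fin d → ℝ) →ₗ[ℝ] (Fin m → ℝ)) (c : Fin m → ℝ) {S : Type} [Fintype S]
    (e : S → Fin (n + p)) (j : Fin m) (z : Fin d ⊕ S → ℝ) :
    MvPolynomial.eval z (fpoly A blk L c e j) =
      (L (fun t => z (Sum.inl t)) j + c j) * ∏ s, z (Sum.inr s) ^ expo A blk j (e s) := by
  rw [L_sum]
  simp [fpoly, map_prod]

theorem prod_log_deriv {σ S : Type} (D : Derivation ℝ (MvPolynomial σ ℝ) (MvPolynomial σ ℝ))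
    (z : σ → ℝ) (x : S → σ) (hz : ∀ s, 0 < z (x s)) (E : S → ℕ) (T : Finset S) :
    MvPolynomial.eval z (D (∏ s ∈ T, MvPolynomial.X (x s) ^ E s)) =
      (∏ s ∈ T, z (x s) ^ E s) *
        ∑ s ∈ T, (E s : ℝ) * (MvPolynomial.eval z (D (MvPolynomial.X (x s))) / z (x s)) := by
  classical
  induction T using Finset.induction_on with
  | empty => simp
  | insert s T hs ih =>
    rw [Finset.prod_insert hs, Finset.prod_insert hs, Finset.sum_insert hs, D.leibniz]
    simp only [smul_eq_mul, map_add, map_mul, ih, map_pow, MvPolynomial.eval_X, map_prod,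
      D.leibniz_pow, nsmul_eq_mul, map_natCast]
    have h0 := (hz s).ne'
    rcases Nat.eq_zero_or_pos (E s) with h | h
    · simp [h]
    · obtain ⟨k, hk⟩ := Nat.exists_eq_succ_of_ne_zero h.ne'
      rw [hk]
      simp only [Nat.succ_eq_add_one, Nat.add_sub_cancel, pow_succ]
      field_simp
      ring

theorem fpoly_deriv {n m p d : ℕ} (A : Matrix (Fin m) (Fin n) ℤ) (blk : Fin m → Fin p)
    (L : (Fin d → ℝ) →ₗ[ℝ] (Fin m → ℝ)) (c : Fin m → ℝ) {S : Type} [Fintype S]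
    (e : S → Fin (n + p)) (j : Fin m) (z : Fin d ⊕ S → ℝ)
    (D : Derivation ℝ (MvPolynomial (Fin d ⊕ S) ℝ) (MvPolynomial (Fin d ⊕ S) ℝ))
    (hz : ∀ s, 0 < z (Sum.inr s)) (hh : 0 < L (fun t => z (Sum.inl t)) j + c j) :
    MvPolynomial.eval z (D (fpoly A blk L c e j)) = MvPolynomial.eval z (fpoly A blk L c e j) *
      (L (fun t => MvPolynomial.eval z (D (MvPolynomial.X (Sum.inl t)))) j /
          (L (fun t => z (Sum.inl t)) j + c j) +
        ∑ s, (expo A blk j (e s) : ℝ) *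
          (MvPolynomial.eval z (D (MvPolynomial.X (Sum.inr s))) / z (Sum.inr s))) := by
  rw [fpoly_eval, fpoly, D.leibniz]
  simp only [smul_eq_mul, map_add, map_mul]
  rw [prod_log_deriv D z Sum.inr hz]
  rw [L_sum L (fun t => MvPolynomial.eval z (D (MvPolynomial.X (Sum.inl t))))]
  have h1 : MvPolynomial.eval z (∑ t, MvPolynomial.C (L (Pi.single t 1) j) *
      MvPolynomial.X (Sum.inl t)) = L (fun t => z (Sum.inl t)) j := by
    rw [L_sum]; simp
  have h2 : MvPolynomial.eval z (D (∑ t, MvPolynomial.C (L (Pi.single t 1) j) *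
      MvPolynomial.X (Sum.inl t))) =
      ∑ t, L (Pi.single t 1) j * MvPolynomial.eval z (D (MvPolynomial.X (Sum.inl t))) := by
    rw [map_sum, map_sum]
    refine Finset.sum_congr rfl fun t _ => ?_
    rw [D.leibniz, ← MvPolynomial.algebraMap_eq, D.map_algebraMap]
    simp [MvPolynomial.algebraMap_eq]
  have h3 : D (MvPolynomial.C (c j)) = 0 := by
    rw [← MvPolynomial.algebraMap_eq, D.map_algebraMap]
  rw [h1, h2, h3]
  simp only [MvPolynomial.eval_C, map_prod, map_pow, MvPolynomial.eval_X, map_zero, add_zero]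
  have := hh.ne'
  field_simp
  ring

theorem ker_W {n m p w : ℕ} {A : Matrix (Fin m) (Fin n) ℤ} {blk : Fin m → Fin p}
    {W : Matrix (Fin w) (Fin m) ℝ} (hW : isSolvabilityMatrix A blk W) (v : Fin m → ℝ)
    (hv : W.mulVec v = 0) : ∃ u, (srcMat A blk).mulVec u = v := by
  have hle : LinearMap.range (srcMat A blk).mulVecLin ≤ LinearMap.ker W.mulVecLin := by
    rintro _ ⟨u, rfl⟩
    rw [LinearMap.mem_ker, Matrix.mulVecLin_apply, Matrix.mulVecLin_apply, Matrix.mulVec_mulVec,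
      hW.1, Matrix.zero_mulVec]
  have h1 := LinearMap.finrank_range_add_finrank_ker W.mulVecLin
  have h2 := hW.2.1
  have h3 := hW.2.2
  rw [Matrix.rank] at h2 h3
  rw [h2] at h1
  simp only [Module.finrank_fintype_fun_eq_card, Fintype.card_fin] at h1
  have h4 := Submodule.eq_of_le_of_finrank_le hle (by omega)
  have h5 : v ∈ LinearMap.range (srcMat A blk).mulVecLin := by
    rw [h4]; exact hv
  exact h5

theorem lift_Aset {n m p d w : ℕ} {Γ : Matrix (Fin n) (Fin m) ℤ} {A : Matrix (Fin m) (Fin n) ℤ}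
    (hA : ∀ i j, 0 ≤ A i j) {blk : Fin m → Fin p}
    {Y : Set (Fin d → ℝ)} {h : (Fin d → ℝ) → (Fin m → ℝ)}
    {L : (Fin d → ℝ) →ₗ[ℝ] (Fin m → ℝ)} {c : Fin m → ℝ} {bY : Fin d → Fin p}
    (H : LinData Γ blk Y h L c bY)
    {W : Matrix (Fin w) (Fin m) ℝ} (hW : isSolvabilityMatrix A blk W)
    {S : Type} [Fintype S] (e : S → Fin (n + p))
    (he : ∀ u, ∃ c : S → ℝ, ∀ j, (srcMat A blk).mulVec u j = ∑ s, srcMat A blk j (e s) * c s)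
    (κ : Fin m → ℝ) (hκ : κ ∈ posOrth m) (α : Fin d → ℝ) (hα : α ∈ Aset W Y h κ) :
    ∃ z : Fin d ⊕ S → ℝ, (∀ j, MvPolynomial.eval z (fpoly A blk L c e j) = κ j) ∧
      (fun t => z (Sum.inl t)) = α := by
  obtain ⟨hαY, hα⟩ := hα
  rw [powVec_eq_iff _ _ _ (H.pos α hαY) hκ] at hα
  obtain ⟨u, hu⟩ := ker_W hW ((fun j => Real.log (κ j)) - (fun j => Real.log (h α j))) (by
    rw [Matrix.mulVec_sub, hα, sub_self])
  obtain ⟨y, hy⟩ := he u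
  refine ⟨Sum.elim α (fun s => Real.exp (y s)), fun j => ?_, rfl⟩
  rw [fpoly_eval]
  simp only [Sum.elim_inl, Sum.elim_inr]
  have h1 : L (fun t => α t) j + c j = h α j := by rw [H.aff]; rfl
  have h2 : ∏ s, Real.exp (y s) ^ expo A blk j (e s) = κ j / h α j := by
    have h3 := hy j
    rw [hu, Pi.sub_apply, ← Real.log_div (hκ j).ne' (H.pos α hαY j).ne'] at h3
    rw [← Real.exp_log (div_pos (hκ j) (H.pos α hαY j)), h3, Real.exp_sum]
    refine Finset.prod_congr rfl fun s _ => ?_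
    rw [← expo_cast A hA, Real.exp_nat_mul]
  rw [h1, h2]
  have := (H.pos α hαY j).ne'
  field_simp

theorem isOpen_posOrth (m : ℕ) : IsOpen (posOrth m) := by
  have : posOrth m = ⋂ i, {x | 0 < x i} := by
    ext x; simp [posOrth]
  rw [this]
  exact isOpen_iInter_of_finite fun i => isOpen_lt continuous_const (continuous_apply i)

theorem finite_of_poly {m d w : ℕ} (W : Matrix (Fin w) (Fin m) ℝ)
    (Y : Set (Fin d → ℝ)) (h : (Fin d → ℝ) → (Fin m → ℝ)) (F : MvPolynomial (Fin m) ℝ)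
    (hF : F ≠ 0) (hfin : ∀ κ ∈ posOrth m, MvPolynomial.eval κ F ≠ 0 → (Aset W Y h κ).Finite) :
    genericallyFiniteAset W Y h :=
  ⟨F, exists_pt F hF _ (isOpen_posOrth m) ⟨fun _ => 1, fun _ => one_pos⟩, hfin⟩

theorem part_sd {n m p d w : ℕ} {Γ : Matrix (Fin n) (Fin m) ℤ} {A : Matrix (Fin m) (Fin n) ℤ}
    (hA : ∀ i j, 0 ≤ A i j) {blk : Fin m → Fin p}
    {Y : Set (Fin d → ℝ)} {h : (Fin d → ℝ) → (Fin m → ℝ)}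
    {L : (Fin d → ℝ) →ₗ[ℝ] (Fin m → ℝ)} {c : Fin m → ℝ} {bY : Fin d → Fin p}
    (H : LinData Γ blk Y h L c bY)
    {W : Matrix (Fin w) (Fin m) ℝ} (hW : isSolvabilityMatrix A blk W)
    (hsd : stronglyDegenerate Γ A) : genericallyFiniteAset W Y h := by
  classical
  obtain ⟨S, _, e, hcard, he⟩ := exists_cols (srcMat A blk)
  by_cases hf : AlgebraicIndependent ℝ (fpoly A blk L c e)
  · exfalso
    choose D g hg hD using exists_deriv _ hf
    let U : Set (Fin d ⊕ S → ℝ) := {z | (fun t => z (Sum.inl t)) ∈ Y ∧ ∀ s, 0 < z (Sum.inr s)}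
    have hU : IsOpen U := by
      have hcont : Continuous (fun (z : Fin d ⊕ S → ℝ) (t : Fin d) => z (Sum.inl t)) := by fun_prop
      apply (H.op.preimage hcont).inter
      have : {z : Fin d ⊕ S → ℝ | ∀ s, 0 < z (Sum.inr s)} = ⋂ s, {z | 0 < z (Sum.inr s)} := by
        ext z; simp
      change IsOpen {z : Fin d ⊕ S → ℝ | ∀ s, 0 < z (Sum.inr s)}
      rw [this]
      exact isOpen_iInter_of_finite fun s => isOpen_lt continuous_const (continuous_apply _)
    have hUne : U.Nonempty := by
      obtain ⟨α, hα⟩ := H.ne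
      exact ⟨Sum.elim α (fun _ => 1), hα, fun s => one_pos⟩
    obtain ⟨z, ⟨hzY, hzS⟩, hz⟩ := exists_pt (∏ j, g j)
      (Finset.prod_ne_zero_iff.mpr fun j _ => hg j) U hU hUne
    rw [map_prod, Finset.prod_ne_zero_iff] at hz
    set α : Fin d → ℝ := fun t => z (Sum.inl t) with hα
    have hpos : ∀ j, 0 < L α j + c j := by
      intro j
      have := H.pos α hzY j
      rwa [H.aff] at this
    refine key2 H α hzY (A := A) ?_ hsd
    let Ψ : ((Fin d → ℝ) × (Fin (n + p) → ℝ)) →ₗ[ℝ] (Fin m → ℝ) :=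
      { toFun := fun q j => L q.1 j / h α j + (srcMat A blk).mulVec q.2 j
        map_add' := fun q q' => by
          ext j
          simp only [Prod.fst_add, Prod.snd_add, map_add, Matrix.mulVec_add, Pi.add_apply]
          ring
        map_smul' := fun a q => by
          ext j
          simp only [Prod.smul_fst, Prod.smul_snd, map_smul, Matrix.mulVec_smul, Pi.smul_apply,
            smul_eq_mul, RingHom.id_apply]
          ring }
    suffices hs : ∀ a, ∃ q, Ψ q = a by
      intro a
      obtain ⟨q, hq⟩ := hs a
      exact ⟨q.1, q.2, fun j => (congrFun hq j).symm⟩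
    suffices hs : ∀ i, ∃ q, Ψ q = Pi.single i 1 by
      intro a
      choose q hq using hs
      refine ⟨∑ i, a i • q i, ?_⟩
      rw [map_sum]
      simp only [map_smul, hq]
      ext j
      simp [Finset.sum_apply, Pi.single_apply]
    intro i
    let μ : S → ℝ := fun s => MvPolynomial.eval z (D i (MvPolynomial.X (Sum.inr s))) / z (Sum.inr s)
    let δ : Fin d → ℝ := fun t => MvPolynomial.eval z (D i (MvPolynomial.X (Sum.inl t)))
    have hcalc : Ψ (δ, ∑ s, μ s • Pi.single (e s) (1:ℝ)) =
        (MvPolynomial.eval z (g i) / MvPolynomial.eval z (fpoly A blk L c e i)) •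
          Pi.single i (1:ℝ) := by
      ext j
      have h1 := fpoly_deriv A blk L c e j z (D i) hzS (hpos j)
      rw [hD] at h1
      have h2 : 0 < MvPolynomial.eval z (fpoly A blk L c e j) := by
        rw [fpoly_eval]
        exact mul_pos (hpos j) (Finset.prod_pos fun s _ => pow_pos (hzS s) _)
      have h3 : (srcMat A blk).mulVec (∑ s, μ s • Pi.single (e s) (1:ℝ)) j =
          ∑ s, (expo A blk j (e s) : ℝ) * μ s := by
        rw [Matrix.mulVec_sum, Finset.sum_apply]
        refine Finset.sum_congr rfl fun s _ => ?_
        rw [Matrix.mulVec_smul, Matrix.mulVec_single_one, expo_cast A hA]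
        simp [Matrix.col, mul_comm]
      have h4 : h α j = L α j + c j := by rw [H.aff]; rfl
      change L δ j / h α j + (srcMat A blk).mulVec (∑ s, μ s • Pi.single (e s) (1:ℝ)) j = _
      rw [h3, h4]
      change _ = MvPolynomial.eval z (fpoly A blk L c e j) *
        (L δ j / (L α j + c j) + ∑ s, (expo A blk j (e s) : ℝ) * μ s) at h1
      rw [Pi.smul_apply, smul_eq_mul]
      by_cases hij : j = i
      · subst hij
        simp only [if_true] at h1
        rw [Pi.single_eq_same, h1]
        field_simp
      · simp only [hij, if_false, map_zero] at h1
        rw [Pi.single_eq_of_ne hij, mul_zero]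
        exact (mul_eq_zero.mp h1.symm).resolve_left h2.ne'
    have hne : MvPolynomial.eval z (g i) / MvPolynomial.eval z (fpoly A blk L c e i) ≠ 0 := by
      apply div_ne_zero (hz i (Finset.mem_univ _))
      rw [fpoly_eval]
      exact (mul_pos (hpos i) (Finset.prod_pos fun s _ => pow_pos (hzS s) _)).ne'
    exact ⟨_ • (δ, ∑ s, μ s • Pi.single (e s) (1:ℝ)), by
      rw [map_smul, hcalc, inv_smul_smul₀ hne]⟩
  · rw [algebraicIndependent_iff] at hf
    push Not at hf
    obtain ⟨F, hF, hF0⟩ := hf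
    refine finite_of_poly W Y h F hF0 fun κ hκ hκF => ?_
    convert Set.finite_empty
    rw [Set.eq_empty_iff_forall_notMem]
    intro α hα
    obtain ⟨z, hz, -⟩ := lift_Aset hA H hW e he κ hκ α hα
    apply hκF
    have h1 := congrArg (MvPolynomial.eval z) hF
    rw [map_zero, ← MvPolynomial.coe_aeval_eq_eval] at h1
    rw [← h1, ← MvPolynomial.coe_aeval_eq_eval]
    change _ = (MvPolynomial.aeval z) ((MvPolynomial.aeval (fpoly A blk L c e)) F)
    rw [← AlgHom.comp_apply, MvPolynomial.comp_aeval]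
    have : κ = fun i => (MvPolynomial.aeval z) (fpoly A blk L c e i) := by
      ext i; rw [← hz i]; rfl
    rw [this]; rfl

theorem part_fin {n m p d w : ℕ} {Γ : Matrix (Fin n) (Fin m) ℤ} {A : Matrix (Fin m) (Fin n) ℤ}
    (hA : ∀ i j, 0 ≤ A i j) {blk : Fin m → Fin p}
    {Y : Set (Fin d → ℝ)} {h : (Fin d → ℝ) → (Fin m → ℝ)}
    {L : (Fin d → ℝ) →ₗ[ℝ] (Fin m → ℝ)} {c : Fin m → ℝ} {bY : Fin d → Fin p}
    (H : LinData Γ blk Y h L c bY)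
    {W : Matrix (Fin w) (Fin m) ℝ} (hW : isSolvabilityMatrix A blk W)
    (hle : d + (srcMat A blk).rank ≤ m) : genericallyFiniteAset W Y h := by
  obtain ⟨S, _, e, hcard, he⟩ := exists_cols (srcMat A blk)
  obtain ⟨F, hF0, hF⟩ := gen_fin (fpoly A blk L c e) (by
    rw [Fintype.card_sum, hcard, Fintype.card_fin]; exact hle)
  refine finite_of_poly W Y h F hF0 fun κ hκ hκF => ?_
  refine ((hF κ hκF).image (fun z t => z (Sum.inl t))).subset ?_
  intro α hα
  obtain ⟨z, hz, hza⟩ := lift_Aset hA H hW e he κ hκ α hα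
  exact ⟨z, hz, hza⟩

theorem part_inf {n m p d w : ℕ} {Γ : Matrix (Fin n) (Fin m) ℤ} {A : Matrix (Fin m) (Fin n) ℤ}
    {blk : Fin m → Fin p}
    {Y : Set (Fin d → ℝ)} {h : (Fin d → ℝ) → (Fin m → ℝ)}
    {L : (Fin d → ℝ) →ₗ[ℝ] (Fin m → ℝ)} {c : Fin m → ℝ} {bY : Fin d → Fin p}
    (H : LinData Γ blk Y h L c bY)
    {W : Matrix (Fin w) (Fin m) ℝ} (hW : isSolvabilityMatrix A blk W)
    (hsd : ¬ stronglyDegenerate Γ A) (hlt : w < d) : ¬ genericallyFiniteAset W Y h := by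
  rintro ⟨F, ⟨κ1, _, hκ1⟩, hF⟩
  have hF0 : F ≠ 0 := by rintro rfl; simp at hκ1
  obtain ⟨α, hα, hs⟩ := key1 H hW hsd
  let φ : (Fin d → ℝ) → (Fin w → ℝ) := fun β => W.mulVec (fun j => Real.log (h β j))
  let LC : Fin m → (Fin d → ℝ) →L[ℝ] ℝ := fun j =>
    (ContinuousLinearMap.proj j).comp (LinearMap.toContinuousLinearMap L)
  have hlog : HasStrictFDerivAt (fun β j => Real.log (h β j))
      (ContinuousLinearMap.pi fun j => (h α j)⁻¹ • LC j) α := by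
    rw [hasStrictFDerivAt_pi]
    intro j
    have h1 : HasStrictFDerivAt (fun β => h β j) (LC j) α := by
      have : (fun β => h β j) = fun β => LC j β + c j := by
        ext β; rw [H.aff]; rfl
      rw [this]
      exact (LC j).hasStrictFDerivAt.add_const _
    exact h1.log (H.pos α hα j).ne'
  have hφ : HasStrictFDerivAt φ ((LinearMap.toContinuousLinearMap W.mulVecLin).comp
      (ContinuousLinearMap.pi fun j => (h α j)⁻¹ • LC j)) α :=
    (LinearMap.toContinuousLinearMap W.mulVecLin).hasStrictFDerivAt.comp α hlog
  have hev := open_fibre φ _ α hφ (by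
    intro b
    obtain ⟨δ, hδ⟩ := hs b
    refine ⟨δ, ?_⟩
    rw [← hδ]
    change W.mulVec _ = _
    congr 1
    ext j
    simp [LC, div_eq_inv_mul]) hlt Y (H.op.mem_nhds hα)
  have hcont : ContinuousAt (fun κ : Fin m → ℝ => W.mulVec (fun j => Real.log (κ j))) (h α) := by
    have h1 : ContinuousAt (fun (κ : Fin m → ℝ) j => Real.log (κ j)) (h α) := by
      rw [continuousAt_pi]
      intro j
      exact (continuous_apply j).continuousAt.log (H.pos α hα j).ne'
    exact (LinearMap.toContinuousLinearMap W.mulVecLin).continuous.continuousAt.comp h1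
  have hev2 := (hcont.eventually hev).and ((isOpen_posOrth m).mem_nhds (H.pos α hα))
  obtain ⟨U, hUsub, hUo, hUm⟩ := mem_nhds_iff.mp hev2
  obtain ⟨κ, hκU, hκF⟩ := exists_pt F hF0 U hUo ⟨_, hUm⟩
  obtain ⟨hinf, hκ⟩ := hUsub hκU
  refine hinf ((hF κ hκ hκF).subset ?_)
  rintro β ⟨hβ, hβe⟩
  exact ⟨hβ, (powVec_eq_iff _ _ _ (H.pos β hβ) hκ).mpr hβe⟩

theorem sd_bound {n m p d w : ℕ} {Γ : Matrix (Fin n) (Fin m) ℤ} {A : Matrix (Fin m) (Fin n) ℤ}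
    {blk : Fin m → Fin p}
    {Y : Set (Fin d → ℝ)} {h : (Fin d → ℝ) → (Fin m → ℝ)}
    {L : (Fin d → ℝ) →ₗ[ℝ] (Fin m → ℝ)} {c : Fin m → ℝ} {bY : Fin d → Fin p}
    (H : LinData Γ blk Y h L c bY)
    {W : Matrix (Fin w) (Fin m) ℝ} (hW : isSolvabilityMatrix A blk W)
    (hsd : ¬ stronglyDegenerate Γ A) : w ≤ d := by
  obtain ⟨α, hα, hs⟩ := key1 H hW hsd
  let Ψ : (Fin d → ℝ) →ₗ[ℝ] (Fin w → ℝ) :=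
    W.mulVecLin.comp (LinearMap.pi fun j => (h α j)⁻¹ • (LinearMap.proj j).comp L)
  have hsurj : Function.Surjective Ψ := by
    intro b
    obtain ⟨δ, hδ⟩ := hs b
    refine ⟨δ, ?_⟩
    rw [← hδ]
    change W.mulVec _ = _
    congr 1
    ext j
    simp [div_eq_inv_mul]
  have := LinearMap.finrank_le_finrank_of_surjective hsurj
  simpa using this

/-- Finiteness of `A_κ`: (i) if `s_P ≤ r` then `A_κ` is generically
finite; (ii) if `s_P > r` then `A_κ` is generically finite iff the network is strongly
degenerate; in particular, if the network is not strongly degenerate, `A_κ` is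
generically finite iff `s_P = r`. -/
theorem statement9 {n m p d w : ℕ}
    (Γ : Matrix (Fin n) (Fin m) ℤ) (A : Matrix (Fin m) (Fin n) ℤ)
    (hA : ∀ i j, 0 ≤ A i j)
    (blk : Fin m → Fin p) (hblk : Function.Surjective blk)
    (hdyn : dynNontrivial Γ) (hfac : factorsOver Γ blk)
    (Y : Set (Fin d → ℝ)) (h : (Fin d → ℝ) → (Fin m → ℝ))
    (hd : m = d + (mR Γ).rank + p)
    (hadm : admissibleH Γ blk Y h)
    (W : Matrix (Fin w) (Fin m) ℝ) (hW : isSolvabilityMatrix A blk W) :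
    ((srcMat A blk).rank ≤ (mR Γ).rank + p → genericallyFiniteAset W Y h) ∧
    ((mR Γ).rank + p < (srcMat A blk).rank →
      (genericallyFiniteAset W Y h ↔ stronglyDegenerate Γ A)) ∧
    (¬ stronglyDegenerate Γ A →
      (genericallyFiniteAset W Y h ↔ (srcMat A blk).rank = (mR Γ).rank + p)) := by
  obtain ⟨L, c, bY, H⟩ := exists_linData Γ blk Y h hadm
  have hw := hW.2.2
  have h1 : (srcMat A blk).rank ≤ (mR Γ).rank + p → genericallyFiniteAset W Y h :=
    fun hle => part_fin hA H hW (by omega)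
  have h2 : (mR Γ).rank + p < (srcMat A blk).rank → ¬ stronglyDegenerate Γ A →
      ¬ genericallyFiniteAset W Y h := fun hlt hsd => part_inf H hW hsd (by omega)
  refine ⟨h1, fun hlt => ⟨fun hg => ?_, fun hsd => part_sd hA H hW hsd⟩,
    fun hsd => ⟨fun hg => ?_, fun heq => h1 heq.le⟩⟩
  · by_contra hsd
    exact h2 hlt hsd hg
  · have hb := sd_bound H hW hsd
    have hn : ¬ (mR Γ).rank + p < (srcMat A blk).rank := fun hlt => h2 hlt hsd hg
    omega

end
end

section
/- An (n,m,r) mass action network that is not strongly degenerate admits a monomial parameterisation if and only if, working with the fundamental partition P_f (for any admissible choices of h and W as in the context), #A_κ ≤ 1 for all κ ∈ ℝ^m_+. Moreover, in this case the exponent matrix of the monomial parameterisation can be taken to be any toricity matrix Q̂ associated with P_f. -/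
open Matrix

noncomputable section

/-- The network admits a monomial parameterisation: there are `ℓ ∈ ℤ_{≥0}` and
`B ∈ ℤ^{n×ℓ}` such that for every `κ`, either `E_κ = ∅` or
`E_κ = {x*_κ ∘ μ^B : μ ∈ ℝ^ℓ_+}` for some `x*_κ ∈ ℝ^n_+`. -/
def admitsMonomialParam {n m : ℕ} (Γ : Matrix (Fin n) (Fin m) ℤ)
    (A : Matrix (Fin m) (Fin n) ℤ) : Prop :=
  ∃ (ℓ : ℕ) (B : Matrix (Fin n) (Fin ℓ) ℤ), ∀ κ ∈ posOrth m,
    Eset Γ A κ = ∅ ∨ ∃ xs ∈ posOrth n,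
      Eset Γ A κ = {x | ∃ μ ∈ posOrth ℓ, x = xs * powVec (mR B) μ}

lemma powVec_pos {k l : ℕ} (M : Matrix (Fin k) (Fin l) ℝ) {x : Fin l → ℝ}
    (hx : ∀ j, 0 < x j) (i : Fin k) : 0 < powVec M x i :=
  Finset.prod_pos fun j _ => Real.rpow_pos_of_pos (hx j) _

lemma powVec_log {k l : ℕ} (M : Matrix (Fin k) (Fin l) ℝ) {x : Fin l → ℝ}
    (hx : ∀ j, 0 < x j) (i : Fin k) :
    Real.log (powVec M x i) = (M *ᵥ fun j => Real.log (x j)) i := by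
  unfold powVec
  rw [Real.log_prod (fun j _ => (Real.rpow_pos_of_pos (hx j) _).ne')]
  simp only [Matrix.mulVec, dotProduct]
  exact Finset.sum_congr rfl fun j _ => Real.log_rpow (hx j) _

lemma powVec_mul {k l : ℕ} (M : Matrix (Fin k) (Fin l) ℝ) {x y : Fin l → ℝ}
    (hx : ∀ j, 0 < x j) (hy : ∀ j, 0 < y j) :
    powVec M (x * y) = powVec M x * powVec M y := by
  funext i
  simp only [powVec, Pi.mul_apply]
  rw [← Finset.prod_mul_distrib]
  exact Finset.prod_congr rfl fun j _ => Real.mul_rpow (hx j).le (hy j).le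

lemma powVec_inv {k l : ℕ} (M : Matrix (Fin k) (Fin l) ℝ) {x : Fin l → ℝ}
    (hx : ∀ j, 0 < x j) :
    powVec M x⁻¹ = (powVec M x)⁻¹ := by
  funext i
  simp only [powVec, Pi.inv_apply]
  rw [← Finset.prod_inv_distrib]
  exact Finset.prod_congr rfl fun j _ => Real.inv_rpow (hx j).le _

lemma powVec_one {k l : ℕ} (M : Matrix (Fin k) (Fin l) ℝ) :
    powVec M 1 = 1 := by
  funext i
  simp [powVec]

lemma srcMat_mulVec {n m p : ℕ} (A : Matrix (Fin m) (Fin n) ℤ) (blk : Fin m → Fin p)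
    (z : Fin (n + p) → ℝ) (j : Fin m) :
    (srcMat A blk *ᵥ z) j =
      (mR A *ᵥ fun k => z (Fin.castAdd p k)) j + z (Fin.natAdd n (blk j)) := by
  simp [Matrix.mulVec, dotProduct, srcMat, Fin.sum_univ_add, mR]

lemma solv_iff {n m p w : ℕ} {A : Matrix (Fin m) (Fin n) ℤ} {blk : Fin m → Fin p}
    {W : Matrix (Fin w) (Fin m) ℝ} (hW : isSolvabilityMatrix A blk W) (u : Fin m → ℝ) :
    W *ᵥ u = 0 ↔ ∃ z, srcMat A blk *ᵥ z = u := by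
  obtain ⟨h0, h1, h2⟩ := hW
  have hle : LinearMap.range (srcMat A blk).mulVecLin ≤ LinearMap.ker W.mulVecLin := by
    rintro _ ⟨z, rfl⟩
    simp [Matrix.mulVec_mulVec, h0]
  have hrn := LinearMap.finrank_range_add_finrank_ker W.mulVecLin
  have heq : LinearMap.range (srcMat A blk).mulVecLin = LinearMap.ker W.mulVecLin := by
    apply Submodule.eq_of_le_of_finrank_eq hle
    change (srcMat A blk).rank = _
    change W.rank + _ = _ at hrn
    simp at hrn
    omega
  have := SetLike.ext_iff.mp heq u
  simp only [LinearMap.mem_range, LinearMap.mem_ker, Matrix.mulVecLin_apply] at this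
  exact this.symm

lemma ker_iff {n m p q : ℕ} {A : Matrix (Fin m) (Fin n) ℤ} {blk : Fin m → Fin p}
    {Q : Matrix (Fin (n + p)) (Fin q) ℝ} (h0 : srcMat A blk * Q = 0) (h1 : Q.rank = q)
    (h2 : (srcMat A blk).rank + q = n + p) (z : Fin (n + p) → ℝ) :
    srcMat A blk *ᵥ z = 0 ↔ ∃ t, Q *ᵥ t = z := by
  have hle : LinearMap.range Q.mulVecLin ≤ LinearMap.ker (srcMat A blk).mulVecLin := by
    rintro _ ⟨z, rfl⟩
    simp [Matrix.mulVec_mulVec, h0]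
  have hrn := LinearMap.finrank_range_add_finrank_ker (srcMat A blk).mulVecLin
  have heq : LinearMap.range Q.mulVecLin = LinearMap.ker (srcMat A blk).mulVecLin := by
    apply Submodule.eq_of_le_of_finrank_eq hle
    change Q.rank = _
    change (srcMat A blk).rank + _ = _ at hrn
    simp at hrn
    omega
  have := SetLike.ext_iff.mp heq z
  simp only [LinearMap.mem_range, LinearMap.mem_ker, Matrix.mulVecLin_apply] at this
  exact this.symm

lemma exists_geninv {a b : ℕ} (S : Matrix (Fin a) (Fin b) ℚ) :
    ∃ G : Matrix (Fin b) (Fin a) ℚ, S * G * S = S := by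
  obtain ⟨g, hg⟩ := S.mulVecLin.rangeRestrict.exists_rightInverse_of_surjective
    (LinearMap.range_rangeRestrict _)
  obtain ⟨g', hg'⟩ := LinearMap.exists_extend g
  refine ⟨LinearMap.toMatrix' g', ?_⟩
  apply Matrix.ext_of_mulVec_single
  intro i
  have h1 := LinearMap.congr_fun hg (S.mulVecLin.rangeRestrict (Pi.single i 1))
  have h2 := LinearMap.congr_fun hg' (S.mulVecLin.rangeRestrict (Pi.single i 1))
  simp only [LinearMap.comp_apply, LinearMap.id_apply] at h1 h2
  have h3 := congrArg Subtype.val h1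
  rw [← h2] at h3
  rw [← Matrix.mulVec_mulVec, ← Matrix.mulVec_mulVec, LinearMap.toMatrix'_mulVec]
  exact h3

lemma exists_int_ker {n m p : ℕ} (A : Matrix (Fin m) (Fin n) ℤ) (blk : Fin m → Fin p) :
    ∃ (q : ℕ) (Q : Matrix (Fin (n + p)) (Fin q) ℤ), ∀ z : Fin (n + p) → ℝ,
      srcMat A blk *ᵥ z = 0 ↔ ∃ t, mR Q *ᵥ t = z := by
  let S : Matrix (Fin m) (Fin (n + p)) ℚ :=
    Matrix.of fun j => Fin.append (fun k => (A j k : ℚ)) (fun i => if blk j = i then 1 else 0)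
  let φ : ℚ →+* ℝ := algebraMap ℚ ℝ
  have hS : S.map φ = srcMat A blk := by
    ext j k
    refine Fin.addCases (fun i => ?_) (fun i => ?_) k
    · simp [S, srcMat, φ]
    · simp only [S, srcMat, Matrix.map_apply, Matrix.of_apply, Fin.append_right]
      split_ifs <;> simp
  obtain ⟨G, hG⟩ := exists_geninv S
  let P : Matrix (Fin (n + p)) (Fin (n + p)) ℚ := 1 - G * S
  obtain ⟨b, hb⟩ := IsLocalization.exist_integer_multiples_of_finite (nonZeroDivisors ℤ)
    (fun ij : Fin (n + p) × Fin (n + p) => P ij.1 ij.2)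
  have hb0 : ((b : ℤ) : ℝ) ≠ 0 := by
    have := nonZeroDivisors.ne_zero b.2
    exact_mod_cast this
  choose f hf using hb
  have hQ : mR (Matrix.of fun i j => f (i, j)) = ((b : ℤ) : ℝ) • P.map φ := by
    ext i j
    have := hf (i, j)
    simp only [Algebra.smul_def, algebraMap_int_eq, eq_intCast] at this
    have h2 := congrArg φ this
    simpa [mR, φ] using h2
  have hPm : P.map φ = 1 - G.map φ * srcMat A blk := by
    rw [← hS, ← Matrix.map_mul]
    rw [Matrix.map_sub φ (map_sub φ), Matrix.map_one φ (map_zero φ) (map_one φ)]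
  have hGm : srcMat A blk * G.map φ * srcMat A blk = srcMat A blk := by
    rw [← hS, ← Matrix.map_mul, ← Matrix.map_mul, hG]
  refine ⟨n + p, Matrix.of fun i j => f (i, j), fun z => ⟨fun hz => ?_, ?_⟩⟩
  · refine ⟨((b : ℤ) : ℝ)⁻¹ • z, ?_⟩
    rw [hQ, hPm, Matrix.smul_mulVec, Matrix.mulVec_smul, smul_smul, mul_inv_cancel₀ hb0, one_smul,
      Matrix.sub_mulVec, ← Matrix.mulVec_mulVec, hz]
    simp
  · rintro ⟨t, rfl⟩
    rw [hQ, hPm, Matrix.smul_mulVec, Matrix.mulVec_smul, Matrix.mulVec_mulVec, Matrix.mul_sub,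
      Matrix.mul_one, ← Matrix.mul_assoc, hGm]
    simp

/-- Solvability: `α ∈ A_κ` iff the flux ray of `α` is attained by some `x`. -/
lemma mem_Aset_iff {n m p d w : ℕ} {Γ : Matrix (Fin n) (Fin m) ℤ}
    {A : Matrix (Fin m) (Fin n) ℤ} {blk : Fin m → Fin p}
    {Y : Set (Fin d → ℝ)} {h : (Fin d → ℝ) → (Fin m → ℝ)}
    (hadm : admissibleH Γ blk Y h)
    {W : Matrix (Fin w) (Fin m) ℝ} (hW : isSolvabilityMatrix A blk W)
    {κ : Fin m → ℝ} (hκ : ∀ j, 0 < κ j) {α : Fin d → ℝ} (hα : α ∈ Y) :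
    α ∈ Aset W Y h κ ↔ ∃ (x : Fin n → ℝ) (lam : Fin p → ℝ), (∀ i, 0 < x i) ∧
      (∀ i, 0 < lam i) ∧ κ * powVec (mR A) x = fluxParam blk h lam α := by
  obtain ⟨-, -, -, -, -, -, hpos, -, -⟩ := hadm
  have hh : ∀ j, 0 < h α j := by
    intro j
    simpa [fluxParam] using (hpos (fun _ => 1) α (fun _ => one_pos) hα).2 j
  have h1 : α ∈ Aset W Y h κ ↔
      W *ᵥ ((fun j => Real.log (h α j)) - fun j => Real.log (κ j)) = 0 := by
    have : α ∈ Aset W Y h κ ↔ powVec W (h α) = powVec W κ :=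
      ⟨fun hx => hx.2, fun hx => ⟨hα, hx⟩⟩
    rw [this, Matrix.mulVec_sub, sub_eq_zero]
    constructor
    · intro e
      funext i
      rw [← powVec_log W hh, ← powVec_log W hκ, e]
    · intro e
      funext i
      apply Real.log_injOn_pos (powVec_pos W hh i) (powVec_pos W hκ i)
      rw [powVec_log W hh, powVec_log W hκ, e]
  rw [h1, solv_iff hW]
  constructor
  · rintro ⟨z, hz⟩
    have hx : ∀ k : Fin n, 0 < Real.exp (z (Fin.castAdd p k)) := fun k => Real.exp_pos _
    refine ⟨fun k => Real.exp (z (Fin.castAdd p k)),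
      fun i => Real.exp (- z (Fin.natAdd n i)), hx, fun i => Real.exp_pos _, ?_⟩
    funext j
    have hz := congrFun hz j
    rw [srcMat_mulVec] at hz
    apply Real.log_injOn_pos (mul_pos (hκ j) (powVec_pos _ hx j))
      (mul_pos (Real.exp_pos _) (hh j))
    rw [Real.log_mul (hκ j).ne' (powVec_pos _ hx j).ne', powVec_log _ hx,
      Real.log_mul (Real.exp_pos _).ne' (hh j).ne']
    simp only [Real.log_exp, Pi.sub_apply] at hz ⊢
    linarith
  · rintro ⟨x, lam, hx, hl, e⟩
    refine ⟨Fin.append (fun k => Real.log (x k)) (fun i => - Real.log (lam i)), ?_⟩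
    funext j
    rw [srcMat_mulVec]
    have e := congrArg Real.log (congrFun e j)
    simp only [Pi.mul_apply, fluxParam] at e
    rw [Real.log_mul (hκ j).ne' (powVec_pos _ hx j).ne', powVec_log _ hx,
      Real.log_mul (hl _).ne' (hh j).ne'] at e
    simp only [Fin.append_left, Fin.append_right, Pi.sub_apply]
    linarith

/-- If all `A_κ` have at most one point, toricity matrices parameterise. -/
lemma toric_of_subsingleton {n m p d w : ℕ} {Γ : Matrix (Fin n) (Fin m) ℤ}
    {A : Matrix (Fin m) (Fin n) ℤ} {blk : Fin m → Fin p}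
    {Y : Set (Fin d → ℝ)} {h : (Fin d → ℝ) → (Fin m → ℝ)}
    (hadm : admissibleH Γ blk Y h)
    {W : Matrix (Fin w) (Fin m) ℝ} (hW : isSolvabilityMatrix A blk W)
    (hs : ∀ κ ∈ posOrth m, (Aset W Y h κ).Subsingleton)
    {q : ℕ} {Q : Matrix (Fin (n + p)) (Fin q) ℝ}
    (hQ : ∀ z, srcMat A blk *ᵥ z = 0 ↔ ∃ t, Q *ᵥ t = z)
    {κ : Fin m → ℝ} (hκ : κ ∈ posOrth m) :
    Eset Γ A κ = ∅ ∨ ∃ xs ∈ posOrth n,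
      Eset Γ A κ = {x | ∃ μ ∈ posOrth q, x = xs * powVec (topRows n p Q) μ} := by
  have hex : ∀ x ∈ Eset Γ A κ, ∃ lam α, (∀ i, 0 < lam i) ∧ α ∈ Aset W Y h κ ∧
      κ * powVec (mR A) x = fluxParam blk h lam α := by
    rintro x ⟨hx, hx0⟩
    obtain ⟨lam, α, hl, hα, e⟩ := hadm.2.2.2.2.2.2.2.1 _ hx0
      (fun j => mul_pos (hκ j) (powVec_pos _ hx j))
    exact ⟨lam, α, hl, (mem_Aset_iff hadm hW hκ hα).2 ⟨x, lam, hx, hl, e⟩, e⟩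
  rcases Set.eq_empty_or_nonempty (Eset Γ A κ) with he | ⟨xs, hxs⟩
  · exact Or.inl he
  right
  refine ⟨xs, hxs.1, ?_⟩
  obtain ⟨lam, α, hl, hα, e⟩ := hex xs hxs
  have hlogs : ∀ j, Real.log (κ j) + (mR A *ᵥ fun k => Real.log (xs k)) j =
      Real.log (κ j * powVec (mR A) xs j) := by
    intro j
    rw [Real.log_mul (hκ j).ne' (powVec_pos _ hxs.1 j).ne', powVec_log _ hxs.1]
  have hh : ∀ j, 0 < h α j := by
    intro j
    simpa [fluxParam] using (hadm.2.2.2.2.2.2.1 (fun _ => 1) α (fun _ => one_pos) hα.1).2 j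
  ext x
  constructor
  · intro hx
    obtain ⟨lam', α', hl', hα', e'⟩ := hex x hx
    obtain rfl := hs κ hκ hα hα'
    obtain ⟨t, ht⟩ := (hQ (Fin.append (fun k => Real.log (x k) - Real.log (xs k))
      (fun i => Real.log (lam i) - Real.log (lam' i)))).1 (by
        funext j
        rw [srcMat_mulVec]
        have e1 := congrArg Real.log (congrFun e j)
        have e2 := congrArg Real.log (congrFun e' j)
        simp only [Pi.mul_apply, fluxParam] at e1 e2
        rw [Real.log_mul (hκ j).ne' (powVec_pos _ hxs.1 j).ne', powVec_log _ hxs.1,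
          Real.log_mul (hl _).ne' (hh j).ne'] at e1
        rw [Real.log_mul (hκ j).ne' (powVec_pos _ hx.1 j).ne', powVec_log _ hx.1,
          Real.log_mul (hl' _).ne' (hh j).ne'] at e2
        simp only [Fin.append_left, Fin.append_right, Pi.zero_apply]
        have : (fun k => Real.log (x k) - Real.log (xs k)) =
          (fun k => Real.log (x k)) - fun k => Real.log (xs k) := rfl
        rw [this, Matrix.mulVec_sub, Pi.sub_apply]
        linarith)
    have hμ : ∀ i, 0 < Real.exp (t i) := fun i => Real.exp_pos _
    refine ⟨fun i => Real.exp (t i), hμ, ?_⟩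
    funext k
    apply Real.log_injOn_pos (hx.1 k) (mul_pos (hxs.1 k) (powVec_pos _ hμ k))
    rw [Real.log_mul (hxs.1 k).ne' (powVec_pos _ hμ k).ne', powVec_log _ hμ]
    have := congrFun ht (Fin.castAdd p k)
    simp only [Fin.append_left] at this
    have h3 : (topRows n p Q *ᵥ fun j => Real.log (Real.exp (t j))) k =
      (Q *ᵥ t) (Fin.castAdd p k) := by
      simp [Matrix.mulVec, dotProduct, topRows]
    rw [h3, this]
    ring
  · rintro ⟨μ, hμ, rfl⟩
    have hx : ∀ k, 0 < (xs * powVec (topRows n p Q) μ) k := fun k =>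
      mul_pos (hxs.1 k) (powVec_pos _ hμ k)
    refine ⟨hx, ?_⟩
    have hz := (hQ _).2 ⟨fun i => Real.log (μ i), rfl⟩
    set z := Q *ᵥ fun i => Real.log (μ i) with hzd
    have hkey : κ * powVec (mR A) (xs * powVec (topRows n p Q) μ) =
        fluxParam blk h (fun i => lam i * Real.exp (- z (Fin.natAdd n i))) α := by
      rw [powVec_mul _ hxs.1 (powVec_pos _ hμ), ← mul_assoc, e]
      funext j
      have hzj := congrFun hz j
      rw [srcMat_mulVec] at hzj
      have : powVec (mR A) (powVec (topRows n p Q) μ) j = Real.exp (- z (Fin.natAdd n (blk j))) := by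
        rw [← Real.exp_log (powVec_pos (mR A) (powVec_pos (topRows n p Q) hμ) j),
          powVec_log _ (powVec_pos _ hμ)]
        congr 1
        have h4 : (fun k => Real.log (powVec (topRows n p Q) μ k)) =
            fun k => z (Fin.castAdd p k) := by
          funext k
          rw [powVec_log _ hμ, hzd]
          simp [Matrix.mulVec, dotProduct, topRows]
        rw [h4]
        simp only [Pi.zero_apply] at hzj
        linarith
      simp only [Pi.mul_apply, fluxParam, this]
      ring
    unfold massAction
    rw [hkey]
    exact (hadm.2.2.2.2.2.2.1 _ α (fun i => mul_pos (hl i) (Real.exp_pos _)) hα.1).1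

/-- A multiplier preserving the positive flux cone is constant on fundamental blocks. -/
lemma const_on_blocks {n m p : ℕ} {Γ : Matrix (Fin n) (Fin m) ℤ} {blk : Fin m → Fin p}
    (hdyn : dynNontrivial Γ)
    (hfund : ∀ (p' : ℕ) (blk' : Fin m → Fin p'), Function.Surjective blk' →
      factorsOver Γ blk' → ∀ j k, blk j = blk k → blk' j = blk' k)
    (a : Fin m → ℝ)
    (ha : ∀ v : Fin m → ℝ, mR Γ *ᵥ v = 0 → (∀ j, 0 < v j) → mR Γ *ᵥ (v * a) = 0) :
    ∀ j k, blk j = blk k → a j = a k := by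
  classical
  obtain ⟨v0, hv0, hv0p⟩ := hdyn
  have hker : ∀ v : Fin m → ℝ, mR Γ *ᵥ v = 0 → mR Γ *ᵥ (v * a) = 0 := by
    intro v hv
    obtain ⟨ε, hε, hpos⟩ : ∃ ε : ℝ, 0 < ε ∧ ∀ j, 0 < (v0 + ε • v) j := by
      have hev : ∀ᶠ ε : ℝ in nhdsWithin 0 (Set.Ioi 0), ∀ j, 0 < (v0 + ε • v) j := by
        rw [Filter.eventually_all]
        intro j
        apply Filter.Eventually.filter_mono nhdsWithin_le_nhds
        have hc : Continuous fun ε : ℝ => (v0 + ε • v) j := by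
          simp only [Pi.add_apply, Pi.smul_apply, smul_eq_mul]
          fun_prop
        exact hc.continuousAt.eventually (lt_mem_nhds (by simpa using hv0p j))
      obtain ⟨ε, h1, h2⟩ := (hev.and self_mem_nhdsWithin).exists
      exact ⟨ε, h2, h1⟩
    have h1 := ha _ (by rw [Matrix.mulVec_add, Matrix.mulVec_smul, hv, hv0]; simp) hpos
    rw [add_mul, Matrix.mulVec_add, ha v0 hv0 hv0p, zero_add, smul_mul_assoc,
      Matrix.mulVec_smul] at h1
    exact (smul_eq_zero.mp h1).resolve_left hε.ne'
  have hpoly : ∀ (P : Polynomial ℝ) (v : Fin m → ℝ), mR Γ *ᵥ v = 0 →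
      mR Γ *ᵥ (fun j => P.eval (a j) * v j) = 0 := by
    intro P v hv
    induction P using Polynomial.induction_on' with
    | add P R hP hR =>
      have : (fun j => (P + R).eval (a j) * v j) =
        (fun j => P.eval (a j) * v j) + fun j => R.eval (a j) * v j := by
        funext j
        simp [add_mul]
      rw [this, Matrix.mulVec_add, hP, hR, add_zero]
    | monomial N c =>
      have hN : mR Γ *ᵥ (v * a ^ N) = 0 := by
        induction N with
        | zero => simpa using hv
        | succ N ih =>
          rw [pow_succ, ← mul_assoc]
          exact hker _ ih
      have : (fun j => (Polynomial.monomial N c).eval (a j) * v j) = c • (v * a ^ N) := by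
        funext j
        simp
        ring
      rw [this, Matrix.mulVec_smul, hN, smul_zero]
  let s : Finset ℝ := Finset.univ.image a
  let e : s ≃ Fin s.card := s.equivFin
  have hmem : ∀ j, a j ∈ s := fun j => Finset.mem_image_of_mem _ (Finset.mem_univ j)
  let blk' : Fin m → Fin s.card := fun j => e ⟨a j, hmem j⟩
  have hsurj : Function.Surjective blk' := by
    intro i
    obtain ⟨j, -, hj⟩ := Finset.mem_image.mp (e.symm i).2
    refine ⟨j, ?_⟩
    simp only [blk']
    rw [← e.apply_symm_apply i]
    congr 1
    exact Subtype.ext hj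
  have hf : factorsOver Γ blk' := by
    intro v hv i
    have h1 := hpoly (Lagrange.basis s id (e.symm i : ℝ)) v hv
    have : (fun j => if blk' j = i then v j else 0) =
        fun j => (Lagrange.basis s id (e.symm i : ℝ)).eval (a j) * v j := by
      funext j
      by_cases hj : blk' j = i
      · have h2 : (e.symm i : ℝ) = a j := by
          rw [← hj]
          simp [blk']
        have h3 := Lagrange.eval_basis_self (s := s) (v := id) (Function.injective_id.injOn)
          (hmem j)
        rw [if_pos hj, h2]
        simp only [id] at h3 ⊢
        erw [h3]
        ring
      · have h2 : (e.symm i : ℝ) ≠ a j := by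
          intro h4
          apply hj
          simp only [blk']
          rw [← e.apply_symm_apply i]
          congr 1
          exact Subtype.ext h4.symm
        have h3 := Lagrange.eval_basis_of_ne (s := s) (v := (id : ℝ → ℝ)) h2 (hmem j)
        rw [if_neg hj]
        simp only [id] at h3 ⊢
        erw [h3]
        ring
    rw [this]
    exact h1
  intro j k hjk
  have := hfund _ blk' hsurj hf j k hjk
  have := e.injective this
  exact congrArg Subtype.val this

/-- Theorem `thm:toric`: a network that is not strongly degenerate
admits a monomial parameterisation iff, with the fundamental partition `P_f`,
`#A_κ ≤ 1` for all `κ`; in that case the exponent matrix can be taken to be any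
toricity matrix `Q̂` for `P_f`. -/
theorem statement10 {n m p d w : ℕ}
    (Γ : Matrix (Fin n) (Fin m) ℤ) (A : Matrix (Fin m) (Fin n) ℤ)
    (hA : ∀ i j, 0 ≤ A i j)
    (blk : Fin m → Fin p) (hblk : Function.Surjective blk)
    (hdyn : dynNontrivial Γ) (hfac : factorsOver Γ blk)
    (hfund : ∀ (p' : ℕ) (blk' : Fin m → Fin p'), Function.Surjective blk' →
      factorsOver Γ blk' → ∀ j k, blk j = blk k → blk' j = blk' k)
    (Y : Set (Fin d → ℝ)) (h : (Fin d → ℝ) → (Fin m → ℝ))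
    (hd : m = d + (mR Γ).rank + p)
    (hadm : admissibleH Γ blk Y h)
    (W : Matrix (Fin w) (Fin m) ℝ) (hW : isSolvabilityMatrix A blk W)
    (hnd : ¬ stronglyDegenerate Γ A) :
    (admitsMonomialParam Γ A ↔ ∀ κ ∈ posOrth m, (Aset W Y h κ).Subsingleton) ∧
    ((∀ κ ∈ posOrth m, (Aset W Y h κ).Subsingleton) →
      ∀ (q : ℕ) (Q : Matrix (Fin (n + p)) (Fin q) ℤ),
        srcMat A blk * mR Q = 0 → (mR Q).rank = q →
        (srcMat A blk).rank + q = n + p →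
        ∀ κ ∈ posOrth m,
          Eset Γ A κ = ∅ ∨ ∃ xs ∈ posOrth n,
            Eset Γ A κ =
              {x | ∃ μ ∈ posOrth q, x = xs * powVec (topRows n p (mR Q)) μ}) := by
  have hmain : ∀ (q : ℕ) (Q : Matrix (Fin (n + p)) (Fin q) ℝ),
      (∀ z, srcMat A blk *ᵥ z = 0 ↔ ∃ t, Q *ᵥ t = z) →
      (∀ κ ∈ posOrth m, (Aset W Y h κ).Subsingleton) → ∀ κ ∈ posOrth m,
      Eset Γ A κ = ∅ ∨ ∃ xs ∈ posOrth n,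
      Eset Γ A κ = {x | ∃ μ ∈ posOrth q, x = xs * powVec (topRows n p Q) μ} :=
    fun q Q hQ hs κ hκ => toric_of_subsingleton hadm hW hs hQ hκ
  refine ⟨⟨?_, ?_⟩, ?_⟩
  · rintro ⟨ℓ, B, hB⟩ κ hκ α hα α' hα'
    obtain ⟨x, lam, hx, hl, e⟩ := (mem_Aset_iff hadm hW hκ hα.1).1 hα
    obtain ⟨x', lam', hx', hl', e'⟩ := (mem_Aset_iff hadm hW hκ hα'.1).1 hα'
    have hflux := hadm.2.2.2.2.2.2.1
    have hxE : x ∈ Eset Γ A κ := ⟨hx, by unfold massAction; rw [e]; exact (hflux _ _ hl hα.1).1⟩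
    have hxE' : x' ∈ Eset Γ A κ :=
      ⟨hx', by unfold massAction; rw [e']; exact (hflux _ _ hl' hα'.1).1⟩
    have hxi : ∀ i, 0 < (x⁻¹) i := fun i => inv_pos.mpr (hx i)
    have hratio : ∃ ν ∈ posOrth ℓ, x' * x⁻¹ = powVec (mR B) ν := by
      rcases hB κ hκ with h0 | ⟨xs, hxs, hE⟩
      · rw [h0] at hxE
        exact absurd hxE (Set.notMem_empty x)
      · rw [hE] at hxE hxE'
        obtain ⟨μ, hμ, e1⟩ := hxE
        obtain ⟨μ', hμ', e2⟩ := hxE'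
        refine ⟨μ' * μ⁻¹, fun i => mul_pos (hμ' i) (inv_pos.mpr (hμ i)), ?_⟩
        rw [powVec_mul (y := μ⁻¹) _ hμ' (fun i => inv_pos.mpr (hμ i)), powVec_inv _ hμ, e1, e2]
        funext i
        have h1 := (hxs i).ne'
        have h2 := (powVec_pos (mR B) hμ i).ne'
        simp only [Pi.mul_apply, Pi.inv_apply]
        field_simp
    obtain ⟨ν, hν, hνe⟩ := hratio
    have hc := const_on_blocks hdyn hfund (powVec (mR A) (x' * x⁻¹)) (by
      intro v hv hvp
      have h1 : (1 : Fin n → ℝ) ∈ Eset Γ A v := by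
        refine ⟨fun i => one_pos, ?_⟩
        unfold massAction
        rw [powVec_one, mul_one, hv]
      rcases hB v hvp with h0 | ⟨xs, hxs, hE⟩
      · rw [h0] at h1
        exact absurd h1 (Set.notMem_empty _)
      · have h2 : x' * x⁻¹ ∈ Eset Γ A v := by
          rw [hE] at h1 ⊢
          obtain ⟨μ, hμ, e1⟩ := h1
          refine ⟨μ * ν, fun i => mul_pos (hμ i) (hν i), ?_⟩
          rw [powVec_mul _ hμ hν, ← mul_assoc, ← e1, one_mul, hνe]
        exact h2.2)
    choose r hr using hblk
    have hap := powVec_pos (mR A) (x := x' * x⁻¹) (fun i => mul_pos (hx' i) (hxi i))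
    have hxx : x' = x * (x' * x⁻¹) := by
      funext i
      have := (hx i).ne'
      simp only [Pi.mul_apply, Pi.inv_apply]
      field_simp
    refine (hadm.2.2.2.2.2.2.2.2
      (fun i => lam i * powVec (mR A) (x' * x⁻¹) (r i)) lam' α α'
      (fun i => mul_pos (hl i) (hap _)) hl' hα.1 hα'.1 ?_).2
    have hpm := powVec_mul (mR A) (y := x' * x⁻¹) hx (fun i => mul_pos (hx' i) (hxi i))
    rw [← hxx] at hpm
    rw [← e', hpm, ← mul_assoc, e]
    funext j
    simp only [fluxParam, Pi.mul_apply]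
    rw [hc (r (blk j)) j (hr _)]
    ring
  · intro hs
    obtain ⟨q, Q, hQ⟩ := exists_int_ker A blk
    refine ⟨q, Matrix.of fun i j => Q (Fin.castAdd p i) j, ?_⟩
    have hBQ : mR (Matrix.of fun i j => Q (Fin.castAdd p i) j) = topRows n p (mR Q) := by
      ext i j
      simp [mR, topRows]
    rw [hBQ]
    exact hmain q (mR Q) hQ hs
  · intro hs q Q h0 h1 h2
    exact hmain q _ (ker_iff h0 h1 h2) hs

end
end

section
/- Let an (n,m,r) mass action network factor over a partition P, with admissible choices of h, W, Q̂ as in the context, and suppose #A_κ ≤ 1 for all κ ∈ ℝ^m_+. Let Z be a matrix of conservation laws, let I ⊆ {1,…,n} be the set of indices lying in the support of at least one row of Z, and let q be the cardinality of {Q̂_i : i ∈ I} ∪ {0}, where Q̂_i denotes the i-th row of Q̂. Then: (ii) if q = n−r+1, then for every κ ∈ ℝ^m_+ and every K ∈ ℝ^{n−r} the set of nondegenerate equilibria in E_κ ∩ S_K has at most one element; (iii) if q = n−r+2, then this set has at most n−r+1 elements. -/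
open Matrix

noncomputable section

theorem aux_rolle {S : Type*} [Fintype S] [DecidableEq S] (β w : S → ℝ) (hβ : ∑ s, β s * w s ≠ 0)
    (T : Finset ℝ) (hpos : ∀ t ∈ T, ∀ s, 0 < 1 + t * w s)
    (hT : ∀ t ∈ T, ∑ s, β s * Real.log (1 + t * w s) = 0) : T.card ≤ Fintype.card S := by
  classical
  set P : Polynomial ℝ := ∑ s, Polynomial.C (β s * w s) *
    ∏ j ∈ Finset.univ.erase s, (1 + Polynomial.C (w j) * Polynomial.X) with hP
  have hP0 : P ≠ 0 := by
    intro h0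
    apply hβ
    have := congrArg (Polynomial.eval 0) h0
    simpa [hP, Polynomial.eval_finsetSum, Polynomial.eval_prod] using this
  rcases Nat.eq_zero_or_pos T.card with hT0 | hTpos
  · omega
  have hS : 0 < Fintype.card S := by
    rw [Fintype.card_pos_iff]
    by_contra hne
    rw [not_nonempty_iff] at hne
    exact hβ (by simp)
  have hdeg : P.natDegree ≤ Fintype.card S - 1 := by
    apply Polynomial.natDegree_sum_le_of_forall_le
    intro s _
    refine (Polynomial.natDegree_C_mul_le _ _).trans ?_
    refine (Polynomial.natDegree_prod_le _ _).trans ?_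
    refine (Finset.sum_le_card_nsmul _ _ 1 ?_).trans ?_
    · intro j _
      rw [add_comm, ← Polynomial.C_1]
      exact Polynomial.natDegree_linear_le
    · simp [Finset.card_erase_of_mem]
  obtain ⟨k, hk⟩ : ∃ k, T.card = k + 1 := ⟨T.card - 1, by omega⟩
  let e := T.orderEmbOfFin hk
  have he : ∀ i, e i ∈ T := fun i => T.orderEmbOfFin_mem hk i
  have key : ∀ i : Fin k, ∃ z, e i.castSucc < z ∧ z < e i.succ ∧ P.eval z = 0 := by
    intro i
    have hlt : e i.castSucc < e i.succ := e.strictMono (Fin.castSucc_lt_succ)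
    have hposI : ∀ t ∈ Set.Icc (e i.castSucc) (e i.succ), ∀ s, 0 < 1 + t * w s := by
      intro t ht s
      have h1 := hpos _ (he i.castSucc) s
      have h2 := hpos _ (he i.succ) s
      rcases le_total 0 (w s) with hw | hw
      · nlinarith [ht.1, mul_le_mul_of_nonneg_right ht.1 hw]
      · nlinarith [mul_le_mul_of_nonpos_right ht.2 hw]
    have hder : ∀ t ∈ Set.Icc (e i.castSucc) (e i.succ),
        HasDerivAt (fun t => ∑ s, β s * Real.log (1 + t * w s))
          (∑ s, β s * (w s / (1 + t * w s))) t := by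
      intro t ht
      apply HasDerivAt.fun_sum
      intro s _
      apply HasDerivAt.const_mul
      apply HasDerivAt.log
      · simpa using ((hasDerivAt_id t).mul_const (w s)).const_add 1
      · exact (hposI t ht s).ne'
    obtain ⟨z, hz, hz0⟩ := exists_hasDerivAt_eq_zero hlt
      (fun t ht => (hder t ht).continuousAt.continuousWithinAt)
      (by rw [hT _ (he _), hT _ (he _)])
      (fun t ht => hder t ⟨ht.1.le, ht.2.le⟩)
    refine ⟨z, hz.1, hz.2, ?_⟩
    have hp := hposI z ⟨hz.1.le, hz.2.le⟩
    have : P.eval z = (∏ j, (1 + z * w j)) * ∑ s, β s * (w s / (1 + z * w s)) := by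
      rw [hP, Polynomial.eval_finsetSum, Finset.mul_sum]
      apply Finset.sum_congr rfl
      intro s _
      rw [← Finset.mul_prod_erase _ _ (Finset.mem_univ s)]
      have hne := (hp s).ne'
      simp only [Polynomial.eval_mul, Polynomial.eval_C, Polynomial.eval_prod, Polynomial.eval_add,
        Polynomial.eval_one, Polynomial.eval_X]
      simp only [mul_comm (w _) z]
      generalize 1 + z * w s = u at hne ⊢
      field_simp
    rw [this, hz0, mul_zero]
  choose z hz1 hz2 hz3 using key
  have hinj : Function.Injective z := by
    apply StrictMono.injective
    intro i j hij
    calc z i < e i.succ := hz2 i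
      _ ≤ e j.castSucc := e.monotone (by
          rw [Fin.le_def]; simp; exact hij)
      _ < z j := hz1 j
  have hcard : (Finset.univ.image z).card ≤ P.natDegree := by
    refine le_trans ?_ (Polynomial.card_roots' P)
    refine le_trans (Finset.card_le_card ?_) (Multiset.toFinset_card_le _)
    intro y hy
    obtain ⟨i, -, rfl⟩ := Finset.mem_image.1 hy
    simp [hP0, Polynomial.IsRoot, hz3]
  rw [Finset.card_image_of_injective _ hinj, Finset.card_univ, Fintype.card_fin] at hcard
  omega

theorem aux_case1 {S : Type*} [Fintype S] {c : ℕ} (M : (S → ℝ) →ₗ[ℝ] (Fin c → ℝ))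
    (B : (Fin c → ℝ) →ₗ[ℝ] (S → ℝ)) (hMB : ∀ ν, M (B ν) = 0 → ν = 0)
    (hS : Fintype.card S = c) (ν : Fin c → ℝ)
    (hν : M (fun s => Real.exp (B ν s) - 1) = 0) : ν = 0 := by
  have hinj : Function.Injective (M ∘ₗ B) := by
    rw [← LinearMap.ker_eq_bot, LinearMap.ker_eq_bot']
    exact hMB
  have hsurj : Function.Surjective M := by
    have := LinearMap.injective_iff_surjective.1 hinj
    exact Function.Surjective.of_comp this
  have hMinj : Function.Injective M :=
    (LinearMap.injective_iff_surjective_of_finrank_eq_finrank (by simp [hS])).2 hsurj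
  have h0 := hMinj (hν.trans (map_zero M).symm)
  apply hMB
  have : B ν = 0 := by
    funext s
    have := congrFun h0 s
    simp only [Pi.zero_apply, sub_eq_zero, Real.exp_eq_one_iff] at this
    simpa using this
  rw [this, map_zero]

theorem aux_case2 {S : Type*} [Fintype S] {c : ℕ} (M : (S → ℝ) →ₗ[ℝ] (Fin c → ℝ))
    (B : (Fin c → ℝ) →ₗ[ℝ] (S → ℝ)) (hMB : ∀ ν, M (B ν) = 0 → ν = 0)
    (hS : Fintype.card S = c + 1) (T : Finset (Fin c → ℝ))
    (hT : ∀ ν ∈ T, M (fun s => Real.exp (B ν s) - 1) = 0) : T.card ≤ c + 1 := by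
  classical
  have hinj : Function.Injective (M ∘ₗ B) := by
    rw [← LinearMap.ker_eq_bot, LinearMap.ker_eq_bot']
    exact hMB
  have hsurj : Function.Surjective M := by
    have := LinearMap.injective_iff_surjective.1 hinj
    exact Function.Surjective.of_comp this
  have hker : Module.finrank ℝ (LinearMap.ker M) = 1 := by
    have := LinearMap.finrank_range_add_finrank_ker M
    rw [LinearMap.range_eq_top.2 hsurj] at this
    simp [hS] at this
    omega
  obtain ⟨⟨w, hwk⟩, hw0, hw⟩ := finrank_eq_one_iff'.1 hker
  have hwne : w ≠ 0 := fun h => hw0 (by ext1; exact h)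
  have hwB : w ∉ LinearMap.range B := by
    rintro ⟨ν, rfl⟩
    have := hMB ν hwk
    simp [this] at hwne
  obtain ⟨f, hfw, hf⟩ := Submodule.exists_le_ker_of_notMem hwB
  have hfsum : ∀ v : S → ℝ, f v = ∑ s, f (Pi.single s 1) * v s := by
    intro v
    conv_lhs => rw [← Finset.univ_sum_single v, map_sum]
    refine Finset.sum_congr rfl fun s _ => ?_
    have : Pi.single s (v s) = v s • (Pi.single s 1 : S → ℝ) := by
      rw [← Pi.single_smul]; simp
    rw [this, map_smul, smul_eq_mul, mul_comm]
  have ht : ∀ ν ∈ T, ∃ t : ℝ, ∀ s, Real.exp (B ν s) = 1 + t * w s := by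
    intro ν hν
    obtain ⟨t, ht⟩ := hw ⟨_, hT ν hν⟩
    refine ⟨t, fun s => ?_⟩
    have := congrFun (congrArg Subtype.val ht) s
    simp at this
    linarith
  choose! t ht using ht
  have htinj : Set.InjOn t T := by
    intro ν hν ν' hν' h
    have : B ν = B ν' := by
      funext s
      have h1 := ht ν hν s
      have h2 := ht ν' hν' s
      rw [h, ← h2] at h1
      exact Real.exp_injective h1
    exact hinj (by simp [this])
  rw [← Finset.card_image_of_injOn htinj, ← hS]
  apply aux_rolle (fun s => f (Pi.single s 1)) w
  · rw [← hfsum]; exact hfw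
  · intro y hy s
    obtain ⟨ν, hν, rfl⟩ := Finset.mem_image.1 hy
    rw [← ht ν hν]; exact Real.exp_pos _
  · intro y hy
    obtain ⟨ν, hν, rfl⟩ := Finset.mem_image.1 hy
    simp_rw [← ht ν hν, Real.log_exp]
    rw [← hfsum]
    exact hf ⟨ν, rfl⟩

theorem aux_powVec {k l : ℕ} (M : Matrix (Fin k) (Fin l) ℝ) (x : Fin l → ℝ) (hx : ∀ i, 0 < x i)
    (i : Fin k) : powVec M x i = Real.exp (∑ j, M i j * Real.log (x j)) := by
  unfold powVec
  rw [Real.exp_sum]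
  refine Finset.prod_congr rfl fun j _ => ?_
  rw [Real.rpow_def_of_pos (hx j), mul_comm]

theorem aux_srcMat {n m p : ℕ} (A : Matrix (Fin m) (Fin n) ℤ) (blk : Fin m → Fin p)
    (u : Fin (n + p) → ℝ) (j : Fin m) :
    (srcMat A blk).mulVec u j =
      (∑ k, (A j k : ℝ) * u (Fin.castAdd p k)) + u (Fin.natAdd n (blk j)) := by
  simp [Matrix.mulVec, dotProduct, srcMat, Fin.sum_univ_add]

theorem aux_inj_of_rank {k l : ℕ} (Q : Matrix (Fin k) (Fin l) ℝ) (hQ : Q.rank = l)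
    (ν : Fin l → ℝ) (h : Q.mulVec ν = 0) : ν = 0 := by
  have h1 := LinearMap.finrank_range_add_finrank_ker Q.mulVecLin
  have h2 : Module.finrank ℝ (LinearMap.range Q.mulVecLin) = l := hQ
  rw [h2] at h1
  simp only [Module.finrank_fin_fun] at h1
  have h3 : Module.finrank ℝ (LinearMap.ker Q.mulVecLin) = 0 := by omega
  rw [Submodule.finrank_eq_zero] at h3
  have : ν ∈ LinearMap.ker Q.mulVecLin := h
  rw [h3] at this
  simpa using this

theorem aux_exact {k l o : ℕ} (M : Matrix (Fin k) (Fin l) ℝ) (N : Matrix (Fin l) (Fin o) ℝ)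
    (hMN : M * N = 0) (hr : M.rank + N.rank = l) (u : Fin l → ℝ) (hu : M.mulVec u = 0) :
    ∃ ν, N.mulVec ν = u := by
  have hle : LinearMap.range N.mulVecLin ≤ LinearMap.ker M.mulVecLin := by
    rintro _ ⟨ν, rfl⟩
    simp [Matrix.mulVec_mulVec, hMN]
  have h1 := LinearMap.finrank_range_add_finrank_ker M.mulVecLin
  have h2 : Module.finrank ℝ (LinearMap.range M.mulVecLin) = M.rank := rfl
  have h3 : Module.finrank ℝ (LinearMap.range N.mulVecLin) = N.rank := rfl
  simp only [Module.finrank_fin_fun] at h1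
  have heq := Submodule.eq_of_le_of_finrank_eq hle (by omega)
  have : u ∈ LinearMap.ker M.mulVecLin := hu
  rw [← heq] at this
  exact this

/-- Toricity: any two equilibria differ by an element of the torus. -/
theorem aux_toric {n m p d w q : ℕ}
    (Γ : Matrix (Fin n) (Fin m) ℤ) (A : Matrix (Fin m) (Fin n) ℤ)
    (blk : Fin m → Fin p)
    (Y : Set (Fin d → ℝ)) (h : (Fin d → ℝ) → (Fin m → ℝ))
    (hadm : admissibleH Γ blk Y h)
    (W : Matrix (Fin w) (Fin m) ℝ) (hW : isSolvabilityMatrix A blk W)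
    (Q : Matrix (Fin (n + p)) (Fin q) ℝ) (hQ : isKernelMatrix A blk Q)
    (κ : Fin m → ℝ) (hκ : κ ∈ posOrth m)
    (hA1 : (Aset W Y h κ).Subsingleton)
    (x x' : Fin n → ℝ) (hx : x ∈ Eset Γ A κ) (hx' : x' ∈ Eset Γ A κ) :
    ∃ ν : Fin q → ℝ, ∀ i, Q.mulVec ν (Fin.castAdd p i) = Real.log (x' i) - Real.log (x i) := by
  obtain ⟨-, -, -, -, -, -, -, hsurj, -⟩ := hadm
  have key : ∀ x ∈ Eset Γ A κ, ∃ (lam : Fin p → ℝ) (α : Fin d → ℝ), α ∈ Aset W Y h κ ∧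
      ∀ j, (∑ k, (A j k : ℝ) * Real.log (x k)) =
        Real.log (h α j) - Real.log (κ j) + Real.log (lam (blk j)) := by
    intro x hx
    obtain ⟨hxp, hx0⟩ := hx
    have hvp : ∀ j, 0 < (κ * powVec (mR A) x) j := fun j => by
      rw [Pi.mul_apply, aux_powVec _ _ hxp]
      exact mul_pos (hκ j) (Real.exp_pos _)
    obtain ⟨lam, α, hlam, hα, hv⟩ := hsurj _ hx0 hvp
    have hhp : ∀ j, 0 < h α j := fun j => by
      have h1 := hvp j
      rw [hv] at h1
      exact (mul_pos_iff_of_pos_left (hlam (blk j))).1 h1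
    have hlog : ∀ j, (∑ k, (A j k : ℝ) * Real.log (x k)) =
        Real.log (h α j) - Real.log (κ j) + Real.log (lam (blk j)) := by
      intro j
      have h1 := congrArg Real.log (congrFun hv j)
      rw [Pi.mul_apply, aux_powVec _ _ hxp, Real.log_mul (hκ j).ne' (Real.exp_pos _).ne',
        Real.log_exp, fluxParam, Real.log_mul (hlam _).ne' (hhp j).ne'] at h1
      simp only [mR, Matrix.map_apply] at h1
      linarith
    refine ⟨lam, α, ⟨hα, ?_⟩, hlog⟩
    funext i
    rw [aux_powVec _ _ hhp, aux_powVec _ _ hκ]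
    congr 1
    rw [← sub_eq_zero, ← Finset.sum_sub_distrib]
    have h0 : W.mulVec ((srcMat A blk).mulVec (Fin.append (fun k => Real.log (x k))
        (fun k => - Real.log (lam k)))) i = 0 := by
      rw [Matrix.mulVec_mulVec, hW.1]; simp
    rw [← h0, Matrix.mulVec, dotProduct]
    refine Finset.sum_congr rfl fun j _ => ?_
    rw [aux_srcMat]
    simp only [Fin.append_left, Fin.append_right]
    rw [hlog]
    ring
  obtain ⟨lam, α, hα, h1⟩ := key x hx
  obtain ⟨lam', α', hα', h1'⟩ := key x' hx'
  obtain rfl := hA1 hα hα'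
  obtain ⟨hQ0, hQr, hQd⟩ := hQ
  obtain ⟨ν, hν⟩ := aux_exact (srcMat A blk) Q hQ0 (by omega)
    (Fin.append (fun k => Real.log (x' k) - Real.log (x k))
        (fun k => - Real.log (lam' k) + Real.log (lam k))) (by
      funext j
      rw [aux_srcMat]
      simp only [Fin.append_left, Fin.append_right, mul_sub, Finset.sum_sub_distrib, h1, h1',
        Pi.zero_apply]
      ring)
  exact ⟨ν, fun i => by rw [hν, Fin.append_left]⟩

/-- Tangent vectors of the torus are in the kernel of the Jacobian. -/
theorem aux_inj {n m p q c : ℕ}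
    (Γ : Matrix (Fin n) (Fin m) ℤ) (A : Matrix (Fin m) (Fin n) ℤ)
    (blk : Fin m → Fin p) (hblk : Function.Surjective blk) (hfac : factorsOver Γ blk)
    (Q : Matrix (Fin (n + p)) (Fin q) ℝ) (hQ : isKernelMatrix A blk Q)
    (κ : Fin m → ℝ)
    (Z : Matrix (Fin c) (Fin n) ℝ) (hc : c + (mR Γ).rank = n)
    (hZ : Z * mR Γ = 0) (hZrank : Z.rank = c)
    (x : Fin n → ℝ) (hx : x ∈ Eset Γ A κ) (hnd : nondegAt Γ A κ x) (ν : Fin q → ℝ)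
    (hν : Z.mulVec (fun i => x i * Q.mulVec ν (Fin.castAdd p i)) = 0) : ν = 0 := by
  obtain ⟨hQ0, hQr, hQd⟩ := hQ
  obtain ⟨hxp, hx0⟩ := hx
  have hz := hnd (fun i => x i * Q.mulVec ν (Fin.castAdd p i)) ?_
    (aux_exact Z (mR Γ) hZ (by omega) _ hν)
  · have htop : ∀ i, Q.mulVec ν (Fin.castAdd p i) = 0 := fun i =>
      (mul_eq_zero.1 (congrFun hz i)).resolve_left (hxp i).ne'
    apply aux_inj_of_rank Q hQr
    have h0 : (srcMat A blk).mulVec (Q.mulVec ν) = 0 := by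
      rw [Matrix.mulVec_mulVec, hQ0]; simp
    funext k
    refine Fin.addCases (fun i => htop i) (fun b => ?_) k
    obtain ⟨j, rfl⟩ := hblk b
    have := congrFun h0 j
    rw [aux_srcMat] at this
    simpa [htop] using this
  · have h0 : (srcMat A blk).mulVec (Q.mulVec ν) = 0 := by
      rw [Matrix.mulVec_mulVec, hQ0]; simp
    set b : Fin p → ℝ := fun k => - Q.mulVec ν (Fin.natAdd n k) with hb
    set v := κ * powVec (mR A) x with hv
    have h1 : (jacMat Γ A κ x).mulVec (fun i => x i * Q.mulVec ν (Fin.castAdd p i)) =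
        (mR Γ).mulVec (fun j => v j * b (blk j)) := by
      unfold jacMat
      simp only [← Matrix.mulVec_mulVec]
      congr 1
      funext j
      rw [Matrix.mulVec_diagonal]
      congr 1
      have := congrFun h0 j
      rw [aux_srcMat] at this
      rw [hb]
      simp only [Pi.zero_apply] at this
      simp only [Matrix.mulVec, dotProduct, Matrix.mulVec_diagonal] at this ⊢
      rw [← eq_neg_iff_add_eq_zero] at this
      rw [← this]
      refine Finset.sum_congr rfl fun i _ => ?_
      have := (hxp i).ne'
      have h2 := Matrix.mulVec_diagonal (fun i => (x i)⁻¹)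
        (fun i => x i * Q.mulVec ν (Fin.castAdd p i)) i
      simp only [Matrix.mulVec, dotProduct] at h2
      rw [h2, inv_mul_cancel_left₀ this]
      simp [mR]
    rw [h1]
    have h2 : (fun j => v j * b (blk j)) =
        ∑ i, b i • (fun j => if blk j = i then v j else 0) := by
      funext j
      simp [Finset.sum_apply, mul_comm]
    rw [h2, Matrix.mulVec_sum]
    refine Finset.sum_eq_zero fun i _ => ?_
    rw [Matrix.mulVec_smul, hfac v hx0 i, smul_zero]

/-- Dimension of the torus is at least the corank (uses nondegeneracy and Lagrange multipliers). -/
theorem aux_dim {n m q c : ℕ}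
    (Γ : Matrix (Fin n) (Fin m) ℤ) (A : Matrix (Fin m) (Fin n) ℤ)
    (L : (Fin q → ℝ) →ₗ[ℝ] (Fin n → ℝ))
    (κ : Fin m → ℝ) (hc : c + (mR Γ).rank = n)
    (x : Fin n → ℝ) (hx : x ∈ Eset Γ A κ) (hnd : nondegAt Γ A κ x)
    (htor : ∀ x' ∈ Eset Γ A κ, ∃ ν, ∀ i, L ν i = Real.log (x' i) - Real.log (x i)) : c ≤ q := by
  have hxp := hx.1
  set u₀ : Fin n → ℝ := fun i => Real.log (x i) with hu₀
  set g := (mR Γ).mulVecLin.rangeRestrict with hg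
  let gc : (Fin m → ℝ) →L[ℝ] LinearMap.range (mR Γ).mulVecLin := LinearMap.toContinuousLinearMap g
  let G : (Fin n → ℝ) → LinearMap.range (mR Γ).mulVecLin :=
    fun u => gc (fun j => κ j * Real.exp ((mR A).mulVec u j))
  have hGE : ∀ u, G u = 0 ↔ (fun i => Real.exp (u i)) ∈ Eset Γ A κ := by
    intro u
    have : κ * powVec (mR A) (fun i => Real.exp (u i)) =
        fun j => κ j * Real.exp ((mR A).mulVec u j) := by
      funext j
      rw [Pi.mul_apply, aux_powVec _ _ (fun i => Real.exp_pos _)]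
      simp [Matrix.mulVec, dotProduct]
    simp only [Eset, massAction, Set.mem_setOf_eq, this, Real.exp_pos, implies_true, true_and]
    rw [Subtype.ext_iff]
    rfl
  have hxu : (fun i => Real.exp (u₀ i)) = x := by
    funext i; simp [hu₀, Real.exp_log (hxp i)]
  have hG0 : G u₀ = 0 := by rw [hGE, hxu]; exact hx
  set v := κ * powVec (mR A) x with hv
  have hvj : ∀ j, v j = κ j * Real.exp ((mR A).mulVec u₀ j) := by
    intro j
    rw [hv, Pi.mul_apply, aux_powVec _ _ hxp]; rfl
  let D : (Fin n → ℝ) →L[ℝ] (Fin m → ℝ) :=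
    LinearMap.toContinuousLinearMap (Matrix.diagonal v * mR A).mulVecLin
  have hD : HasStrictFDerivAt (fun u : Fin n → ℝ => fun j => κ j * Real.exp ((mR A).mulVec u j))
      D u₀ := by
    rw [hasStrictFDerivAt_pi']
    intro j
    let Pj : (Fin n → ℝ) →L[ℝ] ℝ := LinearMap.toContinuousLinearMap
      ((LinearMap.proj j : (Fin m → ℝ) →ₗ[ℝ] ℝ) ∘ₗ (mR A).mulVecLin)
    have h1 : HasStrictFDerivAt (fun u : Fin n → ℝ => (mR A).mulVec u j) Pj u₀ :=
      Pj.hasStrictFDerivAt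
    have h2 := (h1.exp).const_mul (κ j)
    refine h2.congr_fderiv ?_
    refine ContinuousLinearMap.ext fun y => ?_
    show κ j * (Real.exp ((mR A).mulVec u₀ j) * (mR A).mulVec y j) =
      (Matrix.diagonal v * mR A).mulVec y j
    rw [← Matrix.mulVec_mulVec, Matrix.mulVec_diagonal, hvj, mul_assoc]
  have hGd : HasStrictFDerivAt G (gc.comp D) u₀ := gc.hasStrictFDerivAt.comp u₀ hD
  have hDval : ∀ y, ((gc (D y) : LinearMap.range (mR Γ).mulVecLin) : Fin n → ℝ) =
      (mR Γ).mulVec ((Matrix.diagonal v).mulVec ((mR A).mulVec y)) := by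
    intro y
    simp [gc, D, hg, Matrix.mulVec_mulVec, Matrix.mul_assoc]
  have hjac : ∀ y, (jacMat Γ A κ x).mulVec y =
      gc (D (fun i => (x i)⁻¹ * y i)) := by
    intro y
    rw [hDval]
    unfold jacMat
    simp only [← Matrix.mulVec_mulVec]
    congr 3
    funext i
    rw [Matrix.mulVec_diagonal]
  have hsurj : Function.Surjective (gc.comp D) := by
    let sc : (Fin n → ℝ) →ₗ[ℝ] (Fin n → ℝ) :=
      (Matrix.diagonal (fun i => (x i)⁻¹)).mulVecLin
    have hsc : ∀ y, sc y = fun i => (x i)⁻¹ * y i := by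
      intro y; funext i; simp [sc, Matrix.mulVec_diagonal]
    let Jr : LinearMap.range (mR Γ).mulVecLin →ₗ[ℝ] LinearMap.range (mR Γ).mulVecLin :=
      ((gc.comp D).toLinearMap ∘ₗ sc) ∘ₗ (Submodule.subtype _)
    have hJi : Function.Injective Jr := by
      rw [← LinearMap.ker_eq_bot, LinearMap.ker_eq_bot']
      intro z hz
      ext1
      apply hnd z.1
      · rw [hjac, ← hsc]
        exact congrArg Subtype.val hz
      · obtain ⟨a, ha⟩ := z.2
        exact ⟨a, ha⟩
    have := LinearMap.injective_iff_surjective.1 hJi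
    intro y
    obtain ⟨z, hz⟩ := this y
    exact ⟨_, hz⟩
  have hkerle : LinearMap.ker (gc.comp D).toLinearMap ≤ LinearMap.range L := by
    intro z hz
    by_contra hzL
    obtain ⟨f, hfz, hf⟩ := Submodule.exists_le_ker_of_notMem hzL
    have hconst : ∀ u, G u = G u₀ → f u = f u₀ := by
      intro u hu
      rw [hG0, hGE] at hu
      obtain ⟨ν, hν⟩ := htor _ hu
      have h1 : u - u₀ = L ν := by
        funext i; rw [hν]; simp [hu₀]
      have h2 : f (L ν) = 0 := hf ⟨ν, rfl⟩
      rw [← h1, map_sub, sub_eq_zero] at h2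
      exact h2
    let fc : (Fin n → ℝ) →L[ℝ] ℝ := LinearMap.toContinuousLinearMap f
    have hext : IsLocalExtrOn fc {u | G u = G u₀} u₀ := by
      left
      filter_upwards [self_mem_nhdsWithin] with u hu
      exact (hconst u hu).ge
    obtain ⟨Λ, Λ₀, hΛ, hfΛ⟩ := hext.exists_linear_map_of_hasStrictFDerivAt hGd fc.hasStrictFDerivAt
    have hz' : (gc.comp D) z = 0 := hz
    by_cases h0 : Λ₀ = 0
    · apply hΛ
      rw [Prod.mk_eq_zero]
      refine ⟨LinearMap.ext fun y => ?_, h0⟩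
      obtain ⟨y', rfl⟩ := hsurj y
      have := hfΛ y'
      rw [h0, zero_smul, add_zero] at this
      exact this
    · have := hfΛ z
      rw [hz', map_zero, zero_add, smul_eq_mul] at this
      exact hfz ((mul_eq_zero.1 this).resolve_left h0)
  have h1 := LinearMap.finrank_range_add_finrank_ker (gc.comp D).toLinearMap
  have h2 : LinearMap.range (gc.comp D).toLinearMap = ⊤ := LinearMap.range_eq_top.2 hsurj
  rw [h2, finrank_top] at h1
  have h3 : Module.finrank ℝ (LinearMap.range (mR Γ).mulVecLin) = (mR Γ).rank := rfl
  have h4 := Submodule.finrank_mono hkerle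
  have h5 := LinearMap.finrank_range_le L
  simp only [Module.finrank_fin_fun] at h1 h5
  omega

/-- Collecting terms with equal exponents. -/
theorem aux_collect {n q : ℕ} (S : Set (Fin q → ℝ)) [Fintype S] (b : Fin n → (Fin q → ℝ))
    (z : Fin n → ℝ) (hS : ∀ i, z i ≠ 0 → b i ≠ 0 → b i ∈ S)
    (φ : (Fin q → ℝ) → ℝ) (hφ : φ 0 = 0) [DecidableEq (Fin q → ℝ)] :
    ∑ s : S, (∑ i, if b i = s.1 then z i else 0) * φ s.1 = ∑ i, z i * φ (b i) := by
  simp_rw [Finset.sum_mul]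
  rw [Finset.sum_comm]
  refine Finset.sum_congr rfl fun i _ => ?_
  by_cases hi : b i ∈ S
  · rw [Finset.sum_eq_single (⟨b i, hi⟩ : S)]
    · simp
    · intro s _ hs
      rw [if_neg, zero_mul]
      intro h; exact hs (Subtype.ext h.symm)
    · simp
  · have : z i * φ (b i) = 0 := by
      by_cases h1 : z i = 0
      · simp [h1]
      · by_cases h2 : b i = 0
        · simp [h2, hφ]
        · exact absurd (hS i h1 h2) hi
    rw [this]
    refine Finset.sum_eq_zero fun s _ => ?_
    rw [if_neg, zero_mul]
    intro h; exact hi (h ▸ s.2)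

theorem aux_main {n m p d w q c : ℕ}
    (Γ : Matrix (Fin n) (Fin m) ℤ) (A : Matrix (Fin m) (Fin n) ℤ)
    (blk : Fin m → Fin p) (hblk : Function.Surjective blk) (hfac : factorsOver Γ blk)
    (Y : Set (Fin d → ℝ)) (h : (Fin d → ℝ) → (Fin m → ℝ))
    (hadm : admissibleH Γ blk Y h)
    (W : Matrix (Fin w) (Fin m) ℝ) (hW : isSolvabilityMatrix A blk W)
    (Q : Matrix (Fin (n + p)) (Fin q) ℝ) (hQ : isKernelMatrix A blk Q)
    (hA1 : ∀ κ ∈ posOrth m, (Aset W Y h κ).Subsingleton)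
    (Z : Matrix (Fin c) (Fin n) ℝ) (hc : c + (mR Γ).rank = n)
    (hZ : Z * mR Γ = 0) (hZrank : Z.rank = c)
    (κ : Fin m → ℝ) (hκ : κ ∈ posOrth m) (K : Fin c → ℝ) (T : Finset (Fin n → ℝ))
    (hT : ↑T ⊆ {x | x ∈ Eset Γ A κ ∧ Z.mulVec x = K ∧ nondegAt Γ A κ x})
    (N : ℕ) (hN : Set.ncard
        ({v : Fin q → ℝ | ∃ i : Fin n, (∃ a : Fin c, Z a i ≠ 0) ∧
            v = fun t => Q (Fin.castAdd p i) t} ∪ {0}) = N + 1) :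
    (N = c → T.card ≤ 1) ∧ (N = c + 1 → T.card ≤ c + 1) := by
  classical
  rcases T.eq_empty_or_nonempty with rfl | ⟨x, hxT⟩
  · simp
  obtain ⟨hxE, hxK, hxn⟩ := hT hxT
  have hxp := hxE.1
  have htor := fun x' hx' => aux_toric Γ A blk Y h hadm W hW Q hQ κ hκ (hA1 κ hκ) x x' hxE hx'
  have hinj := aux_inj Γ A blk hblk hfac Q hQ κ Z hc hZ hZrank x hxE hxn
  set U := ({v : Fin q → ℝ | ∃ i : Fin n, (∃ a : Fin c, Z a i ≠ 0) ∧
            v = fun t => Q (Fin.castAdd p i) t} ∪ {0}) with hU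
  have hUfin : U.Finite := by
    apply Set.finite_of_ncard_ne_zero; omega
  let S : Set (Fin q → ℝ) := U \ {0}
  have hSfin : S.Finite := hUfin.subset Set.diff_subset
  haveI : Fintype S := hSfin.fintype
  have hScard : Fintype.card S = N := by
    rw [← Nat.card_eq_fintype_card, Nat.card_coe_set_eq]
    have := Set.ncard_diff_singleton_add_one (a := (0 : Fin q → ℝ)) (s := U) (by simp [hU]) hUfin
    show (U \ {0}).ncard = N
    omega
  let L : (Fin q → ℝ) →ₗ[ℝ] (Fin n → ℝ) :=
    LinearMap.funLeft ℝ ℝ (Fin.castAdd p) ∘ₗ Q.mulVecLin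
  have hL : ∀ ν i, L ν i = Q.mulVec ν (Fin.castAdd p i) := fun ν i => rfl
  have hcq : c ≤ q := aux_dim Γ A L κ hc x hxE hxn htor
  let b : Fin n → (Fin q → ℝ) := fun i t => Q (Fin.castAdd p i) t
  have hLb : ∀ ν i, L ν i = b i ⬝ᵥ ν := fun ν i => rfl
  have hbS : ∀ a i, Z a i * x i ≠ 0 → b i ≠ 0 → b i ∈ S := by
    intro a i h1 h2
    refine ⟨Or.inl ⟨i, ⟨a, left_ne_zero_of_mul h1⟩, rfl⟩, h2⟩
  let Mm : Matrix (Fin c) S ℝ := Matrix.of fun a s => ∑ i, if b i = s.1 then Z a i * x i else 0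
  let Bm : Matrix S (Fin q) ℝ := Matrix.of fun s => s.1
  have hBm : ∀ ν s, Bm.mulVec ν s = s.1 ⬝ᵥ ν := fun ν s => rfl
  have hcol : ∀ (φ : (Fin q → ℝ) → ℝ), φ 0 = 0 → ∀ a,
      Mm.mulVec (fun s => φ s.1) a = ∑ i, Z a i * x i * φ (b i) := by
    intro φ hφ a
    rw [← aux_collect S b (fun i => Z a i * x i) (hbS a) φ hφ]
    rfl
  have hMB : ∀ ν, Mm.mulVecLin (Bm.mulVecLin ν) = 0 → ν = 0 := by
    intro ν hν
    apply hinj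
    rw [← hν]
    funext a
    have := hcol (fun v => v ⬝ᵥ ν) (by simp) a
    refine Eq.trans ?_ this.symm
    simp only [Matrix.mulVec, dotProduct, mul_assoc]
    rfl
  have hqc : q ≤ c := by
    have : Function.Injective (Mm.mulVecLin ∘ₗ Bm.mulVecLin) := by
      rw [← LinearMap.ker_eq_bot, LinearMap.ker_eq_bot']
      exact hMB
    simpa using LinearMap.finrank_le_finrank_of_injective this
  obtain rfl : q = c := le_antisymm hqc hcq
  have hTν : ∀ x' ∈ T, ∃ ν : Fin q → ℝ, (∀ i, x' i = x i * Real.exp (b i ⬝ᵥ ν)) ∧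
      Mm.mulVecLin (fun s => Real.exp (Bm.mulVecLin ν s) - 1) = 0 := by
    intro x' hx'
    obtain ⟨hE', hK', -⟩ := hT hx'
    obtain ⟨ν, hν⟩ := htor x' hE'
    have hx'e : ∀ i, x' i = x i * Real.exp (b i ⬝ᵥ ν) := by
      intro i
      rw [← hLb, hL, hν, Real.exp_sub, Real.exp_log (hxp i), Real.exp_log (hE'.1 i)]
      have := (hxp i).ne'
      field_simp
    refine ⟨ν, hx'e, ?_⟩
    funext a
    have := hcol (fun v => Real.exp (v ⬝ᵥ ν) - 1) (by simp) a
    refine Eq.trans this ?_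
    have h1 := congrFun (hK'.trans hxK.symm) a
    simp only [Matrix.mulVec, dotProduct] at h1
    rw [← sub_eq_zero, ← Finset.sum_sub_distrib] at h1
    rw [Pi.zero_apply, ← h1]
    refine Finset.sum_congr rfl fun i _ => ?_
    rw [hx'e i]; ring
  choose! ν hν1 hν2 using hTν
  have hνinj : Set.InjOn ν T := by
    intro y hy y' hy' hyy
    funext i
    rw [hν1 y hy, hν1 y' hy', hyy]
  constructor
  · intro hNc
    rw [Finset.card_le_one]
    intro y hy y' hy'
    apply hνinj hy hy'
    rw [aux_case1 _ _ hMB (hScard.trans hNc) _ (hν2 y hy),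
      aux_case1 _ _ hMB (hScard.trans hNc) _ (hν2 y' hy')]
  · intro hNc
    rw [← Finset.card_image_of_injOn hνinj]
    apply aux_case2 _ _ hMB (hScard.trans hNc)
    intro y hy
    obtain ⟨y', hy', rfl⟩ := Finset.mem_image.1 hy
    exact hν2 y' hy'

/-- Theorem `thm:bounds_toric`(ii),(iii): suppose `#A_κ ≤ 1` for
all `κ`. Let `I` be the set of indices in the support of some row of `Z`, and let
`q` be the cardinality of `{Q̂_i : i ∈ I} ∪ {0}`. If `q = n−r+1` then each
stoichiometric class contains at most one nondegenerate positive equilibrium; if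
`q = n−r+2` then it contains at most `n−r+1` of them. (Here `c = n − r`.) -/
theorem statement11 {n m p d w q c : ℕ}
    (Γ : Matrix (Fin n) (Fin m) ℤ) (A : Matrix (Fin m) (Fin n) ℤ)
    (hA : ∀ i j, 0 ≤ A i j)
    (blk : Fin m → Fin p) (hblk : Function.Surjective blk)
    (hdyn : dynNontrivial Γ) (hfac : factorsOver Γ blk)
    (Y : Set (Fin d → ℝ)) (h : (Fin d → ℝ) → (Fin m → ℝ))
    (hd : m = d + (mR Γ).rank + p)
    (hadm : admissibleH Γ blk Y h)
    (W : Matrix (Fin w) (Fin m) ℝ) (hW : isSolvabilityMatrix A blk W)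
    (Q : Matrix (Fin (n + p)) (Fin q) ℝ) (hQ : isKernelMatrix A blk Q)
    (hA1 : ∀ κ ∈ posOrth m, (Aset W Y h κ).Subsingleton)
    (Z : Matrix (Fin c) (Fin n) ℝ) (hc : c + (mR Γ).rank = n)
    (hZ : Z * mR Γ = 0) (hZrank : Z.rank = c) :
    (Set.ncard
        ({v : Fin q → ℝ | ∃ i : Fin n, (∃ a : Fin c, Z a i ≠ 0) ∧
            v = fun t => Q (Fin.castAdd p i) t} ∪ {0}) = c + 1 →
      ∀ κ ∈ posOrth m, ∀ K : Fin c → ℝ, ∀ T : Finset (Fin n → ℝ),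
        ↑T ⊆ {x | x ∈ Eset Γ A κ ∧ Z.mulVec x = K ∧ nondegAt Γ A κ x} →
        T.card ≤ 1) ∧
    (Set.ncard
        ({v : Fin q → ℝ | ∃ i : Fin n, (∃ a : Fin c, Z a i ≠ 0) ∧
            v = fun t => Q (Fin.castAdd p i) t} ∪ {0}) = c + 2 →
      ∀ κ ∈ posOrth m, ∀ K : Fin c → ℝ, ∀ T : Finset (Fin n → ℝ),
        ↑T ⊆ {x | x ∈ Eset Γ A κ ∧ Z.mulVec x = K ∧ nondegAt Γ A κ x} →
        T.card ≤ c + 1) := by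
  constructor
  · intro hN κ hκ K T hT
    exact (aux_main Γ A blk hblk hfac Y h hadm W hW Q hQ hA1 Z hc hZ hZrank κ hκ K T hT c hN).1 rfl
  · intro hN κ hκ K T hT
    exact (aux_main Γ A blk hblk hfac Y h hadm W hW Q hQ hA1 Z hc hZ hZrank κ hκ K T hT
      (c + 1) hN).2 rfl

end
end
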